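/- arXiv:0902.1262 — 4 statements merged into one kernel-verified Lean document; each statement's English description precedes it below -/
import Mathlib

section
/- Let k ≥ 2 and let s_1,…,s_k,s_{k+1} be positive integers. Then the signed cyclic sum Σ_{j=1}^{k+1} (−1)^{s_j} ζ_MT(R_j), where for j ≤ k the term ζ_MT(R_j) = ζ_MT(s_1,…,s_{j−1}, s_{k+1}, s_{j+1},…,s_k, s_j) (the j-th entry of (s_1,…,s_k) is replaced by s_{k+1} and then s_j is appended as the last argument) and for j = k+1 the term is (−1)^{s_{k+1}} ζ_MT(s_1,…,s_k,s_{k+1}), is strongly reducible: there exist finitely many rational numbers c_1,…,c_M and, for each m, a finite nonempty list of multiple zeta values ζ(n_1,…,n_d) with positive integer arguments, n_1 ≥ 2 and depth d ≤ k, such that the signed cyclic sum equals Σ_{m=1}^M c_m × (the product of the multiple zeta values in the m-th list). -/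
/-- The Mordell–Tornheim zeta value `ζ_MT(s₁,…,s_{k+1})` of depth `k`. -/
noncomputable def MTZ {k : ℕ} (s : Fin (k + 1) → ℕ) : ℝ :=
  ∑' m : Fin k → ℕ+,
    (∏ j : Fin k, ((m j : ℕ) : ℝ) ^ s j.castSucc)⁻¹ *
      ((∑ j : Fin k, ((m j : ℕ) : ℝ)) ^ s (Fin.last k))⁻¹

/-- The multiple zeta value `ζ(n₁,…,n_d)` (summed over `m₁ > m₂ > ⋯ > m_d ≥ 1`). -/
noncomputable def MZV {d : ℕ} (n : Fin d → ℕ) : ℝ :=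
  ∑' m : {m : Fin d → ℕ+ // ∀ i j : Fin d, i < j → m j < m i},
    (∏ i : Fin d, ((m.1 i : ℕ) : ℝ) ^ n i)⁻¹

/-- The term of a multiple zeta value in terms of the successive differences of its indices, listed
in the order prescribed by `σ`. -/
noncomputable def suffixSumTerm {k : ℕ} (σ : Fin k → Fin k) (b : Fin k → ℕ) (m : Fin k → ℕ+) : ℝ :=
  (∏ j, (∑ i ∈ Finset.Ici j, ((m (σ i) : ℕ) : ℝ)) ^ b j)⁻¹

/-- The nonnegative integer combinations of the functions `suffixSumTerm σ b` with positive
exponents, the leading one being at least `t`. -/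
def suffixSumCombinations (k t : ℕ) : AddSubmonoid ((Fin k → ℕ+) → ℝ) :=
  AddSubmonoid.closure {f | ∃ (σ : Fin k → Fin k) (b : Fin k → ℕ), Function.Injective σ ∧
    (∀ j, 1 ≤ b j) ∧ (∀ j : Fin k, (j : ℕ) = 0 → t ≤ b j) ∧ f = suffixSumTerm σ b}

/-- The values `MZV n` of depth `d + 1` with admissible `n`. -/
def admissibleMZVs (d : ℕ) : Set ℝ :=
  {x | ∃ n : Fin (d + 1) → ℕ, 2 ≤ n 0 ∧ (∀ i, 1 ≤ n i) ∧ x = MZV n}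

theorem Fin.sum_Ici_zero {M : Type*} [AddCommMonoid M] {k : ℕ} (f : Fin (k + 1) → M) :
    ∑ i ∈ Finset.Ici (0 : Fin (k + 1)), f i = ∑ i, f i := by
  congr 1
  ext i
  simp

theorem cast_pnat_pos (n : ℕ+) : (0 : ℝ) < ((n : ℕ) : ℝ) := by
  exact_mod_cast n.pos

theorem inv_prod_pow_partialFraction {ι : Type*} [Fintype ι] [Nonempty ι] [DecidableEq ι]
    (x : ι → ℝ) (hx : ∀ i, 0 < x i) (a : ι → ℕ) (ha : ∀ i, 1 ≤ a i) :
    (∏ j, x j ^ a j)⁻¹ =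
      ∑ i, (∏ j, x j ^ Function.update a i (a i - 1) j)⁻¹ * (∑ j, x j)⁻¹ := by
  have hterm (i : ι) : (∏ j, x j ^ Function.update a i (a i - 1) j)⁻¹ =
      x i * (∏ j, x j ^ a j)⁻¹ := by
    have h : ∏ j, x j ^ a j = x i * ∏ j, x j ^ Function.update a i (a i - 1) j := by
      rw [← Finset.mul_prod_erase _ _ (Finset.mem_univ i),
        ← Finset.mul_prod_erase Finset.univ (fun j => x j ^ Function.update a i (a i - 1) j)
          (Finset.mem_univ i), ← mul_assoc]
      congr 1
      · rw [Function.update_self, ← pow_succ', Nat.sub_add_cancel (ha i)]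
      · refine Finset.prod_congr rfl fun j hj => ?_
        rw [Function.update_of_ne (Finset.ne_of_mem_erase hj)]
    rw [h, mul_inv, ← mul_assoc, mul_inv_cancel₀ (hx i).ne', one_mul]
  have hsum : (∑ j, x j) ≠ 0 := (Finset.sum_pos (fun i _ => hx i) Finset.univ_nonempty).ne'
  simp_rw [hterm, ← Finset.sum_mul]
  field_simp

theorem suffixSumTerm_cons {k : ℕ} (σ : Fin k → Fin k) (hσ : Function.Injective σ) (b : Fin k → ℕ)
    (p : Fin (k + 1)) (s : ℕ) (m : Fin (k + 1) → ℕ+) :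
    suffixSumTerm (Fin.cons p (p.succAbove ∘ σ)) (Fin.cons s b) m =
      suffixSumTerm σ b (m ∘ p.succAbove) * ((∑ j, ((m j : ℕ) : ℝ)) ^ s)⁻¹ := by
  have hσ' : Function.Bijective σ := Finite.injective_iff_bijective.mp hσ
  have hsum : ∑ i : Fin k, ((m (p.succAbove (σ i)) : ℕ) : ℝ) =
      ∑ i : Fin k, ((m (p.succAbove i) : ℕ) : ℝ) :=
    hσ'.sum_comp fun i => ((m (p.succAbove i) : ℕ) : ℝ)
  simp only [suffixSumTerm, Fin.prod_univ_succ, Fin.sum_Ici_succ, Fin.sum_Ici_zero, Fin.cons_zero,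
    Fin.cons_succ, Function.comp_apply, Fin.sum_univ_succ, mul_inv]
  rw [hsum, ← Fin.sum_univ_succ (fun j => ((m j : ℕ) : ℝ)),
    ← Fin.sum_univ_succAbove (fun j => ((m j : ℕ) : ℝ)) p, mul_comm]

theorem mul_mem_suffixSumCombinations {k s t : ℕ} (hs : 1 ≤ s) (hst : t ≤ s) (p : Fin (k + 1))
    {f : (Fin k → ℕ+) → ℝ} (hf : f ∈ suffixSumCombinations k 1) :
    (fun m : Fin (k + 1) → ℕ+ => f (m ∘ p.succAbove) * ((∑ j, ((m j : ℕ) : ℝ)) ^ s)⁻¹) ∈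
      suffixSumCombinations (k + 1) t := by
  induction hf using AddSubmonoid.closure_induction with
  | mem f hf =>
    obtain ⟨σ, b, hσ, hb, -, rfl⟩ := hf
    refine AddSubmonoid.subset_closure
      ⟨Fin.cons p (p.succAbove ∘ σ), Fin.cons s b, ?_, ?_, ?_, ?_⟩
    · rw [Fin.cons_injective_iff]
      refine ⟨?_, Fin.succAbove_right_injective.comp hσ⟩
      rintro ⟨i, hi⟩
      exact Fin.succAbove_ne p _ hi
    · exact Fin.cases (by simpa using hs) (by simpa using hb)
    · intro j hj
      obtain rfl : j = 0 := Fin.ext hj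
      simpa using hst
    · funext m
      rw [suffixSumTerm_cons σ hσ]
  | zero =>
    convert zero_mem (suffixSumCombinations (k + 1) t) using 1
    funext m
    simp
  | add f g _ _ hf hg =>
    convert add_mem hf hg using 1
    funext m
    simp [add_mul]

theorem mordellTornheimTerm_mem_of_depth_pred {k t : ℕ}
    (ih : ∀ a : Fin k → ℕ, (∀ j, 1 ≤ a j) →
      (fun m : Fin k → ℕ+ => (∏ j, ((m j : ℕ) : ℝ) ^ a j)⁻¹) ∈ suffixSumCombinations k 1)
    (a : Fin (k + 1) → ℕ) (ha : ∀ j, 1 ≤ a j) (s : ℕ) (hs : t ≤ s + 1) :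
    (fun m : Fin (k + 1) → ℕ+ =>
      (∏ j, ((m j : ℕ) : ℝ) ^ a j)⁻¹ * ((∑ j, ((m j : ℕ) : ℝ)) ^ s)⁻¹) ∈
        suffixSumCombinations (k + 1) t := by
  induction hw : ∑ j, a j generalizing a s with
  | zero =>
    have := Finset.single_le_sum (f := a) (fun i _ => Nat.zero_le _) (Finset.mem_univ 0)
    have := ha 0
    omega
  | succ w ihw =>
    have hsplit : (fun m : Fin (k + 1) → ℕ+ =>
        (∏ j, ((m j : ℕ) : ℝ) ^ a j)⁻¹ * ((∑ j, ((m j : ℕ) : ℝ)) ^ s)⁻¹) =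
        ∑ i, fun m : Fin (k + 1) → ℕ+ =>
          (∏ j, ((m j : ℕ) : ℝ) ^ Function.update a i (a i - 1) j)⁻¹ *
            ((∑ j, ((m j : ℕ) : ℝ)) ^ (s + 1))⁻¹ := by
      funext m
      rw [inv_prod_pow_partialFraction _ (fun i => cast_pnat_pos (m i)) a ha, Finset.sum_apply,
        Finset.sum_mul]
      refine Finset.sum_congr rfl fun i _ => ?_
      rw [pow_succ', mul_inv, mul_assoc]
    rw [hsplit]
    refine sum_mem fun i _ => ?_
    by_cases hi : a i = 1
    · convert mul_mem_suffixSumCombinations (Nat.le_add_left 1 s) hs i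
        (ih (a ∘ i.succAbove) fun j => ha _) using 1
      funext m
      simp [Fin.prod_univ_succAbove _ i, hi]
    · have hai := ha i
      refine ihw _ (fun j => ?_) (s + 1) (by omega) ?_
      · rcases eq_or_ne j i with rfl | hj
        · rw [Function.update_self]
          omega
        · rw [Function.update_of_ne hj]
          exact ha j
      · rw [Finset.sum_update_of_mem (Finset.mem_univ i)]
        rw [← Finset.add_sum_erase _ _ (Finset.mem_univ i), ← Finset.sdiff_singleton_eq_erase] at hw
        omega

theorem inv_prod_pow_mem_suffixSumCombinations {k : ℕ} (a : Fin k → ℕ) (ha : ∀ j, 1 ≤ a j) :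
    (fun m : Fin k → ℕ+ => (∏ j, ((m j : ℕ) : ℝ) ^ a j)⁻¹) ∈ suffixSumCombinations k 1 := by
  induction k with
  | zero =>
    refine AddSubmonoid.subset_closure
      ⟨id, a, Function.injective_id, ha, fun j => j.elim0, ?_⟩
    funext m
    simp [suffixSumTerm]
  | succ k ih => simpa using mordellTornheimTerm_mem_of_depth_pred ih a ha 0 le_rfl

theorem injective_sum_Ici (k : ℕ) :
    Function.Injective fun (m : Fin k → ℕ) (j : Fin k) => ∑ i ∈ Finset.Ici j, m i := by
  induction k with
  | zero => exact Function.injective_of_subsingleton _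
  | succ k ih =>
    intro m m' h
    have htail : (fun i : Fin k => m i.succ) = fun i => m' i.succ := ih <| by
      funext j
      simpa [Fin.sum_Ici_succ] using congrFun h j.succ
    have hhead := congrFun h 0
    simp only [Fin.sum_Ici_zero, Fin.sum_univ_succ] at hhead
    have hsum : ∑ i : Fin k, m i.succ = ∑ i : Fin k, m' i.succ := by rw [htail]
    funext i
    refine Fin.cases ?_ (fun j => congrFun htail j) i
    omega

theorem exists_sum_Ici_eq {k : ℕ} (N : Fin k → ℕ) (hpos : ∀ i, 0 < N i) (hN : StrictAnti N) :
    ∃ m : Fin k → ℕ, (∀ i, 0 < m i) ∧ ∀ j, ∑ i ∈ Finset.Ici j, m i = N j := by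
  induction k with
  | zero => exact ⟨N, hpos, fun j => j.elim0⟩
  | succ k ih =>
    obtain ⟨m, hm, hmN⟩ := ih (fun i => N i.succ) (fun i => hpos _)
      fun i j hij => hN (Fin.succ_lt_succ_iff.mpr hij)
    have hlt : ∑ i, m i < N 0 := by
      cases k with
      | zero => simpa using hpos 0
      | succ k =>
        rw [← Fin.sum_Ici_zero, hmN]
        exact hN (Fin.succ_pos 0)
    refine ⟨Fin.cons (N 0 - ∑ i, m i) m, Fin.cases ?_ ?_, Fin.cases ?_ ?_⟩
    · simpa using hlt
    · simpa using hm
    · rw [Fin.sum_Ici_zero, Fin.sum_univ_succ]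
      simp only [Fin.cons_zero, Fin.cons_succ]
      omega
    · simpa [Fin.sum_Ici_succ] using hmN

theorem sum_Ici_pos {k : ℕ} (m : Fin k → ℕ+) (j : Fin k) :
    0 < ∑ i ∈ Finset.Ici j, (m i : ℕ) :=
  Finset.sum_pos (fun i _ => (m i).pos) ⟨j, Finset.mem_Ici.mpr le_rfl⟩

theorem sum_Ici_lt {k : ℕ} (m : Fin k → ℕ+) {i j : Fin k} (hij : i < j) :
    ∑ l ∈ Finset.Ici j, (m l : ℕ) < ∑ l ∈ Finset.Ici i, (m l : ℕ) :=
  Finset.sum_lt_sum_of_subset (Finset.Ici_subset_Ici.mpr hij.le) (Finset.mem_Ici.mpr le_rfl)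
    (by simpa using hij) (m i).pos fun _ _ _ => Nat.zero_le _

/-- Taking suffix sums identifies positive sequences with strictly decreasing ones. -/
noncomputable def suffixSumEquiv (k : ℕ) :
    (Fin k → ℕ+) ≃ {m : Fin k → ℕ+ // ∀ i j : Fin k, i < j → m j < m i} :=
  Equiv.ofBijective
    (fun m => ⟨fun j => ⟨∑ i ∈ Finset.Ici j, (m i : ℕ), sum_Ici_pos m j⟩,
      fun _ _ hij => sum_Ici_lt m hij⟩) <| by
    refine ⟨fun m m' h => ?_, fun ⟨N, hN⟩ => ?_⟩
    · have hval := injective_sum_Ici k (a₁ := fun i => (m i : ℕ)) (a₂ := fun i => (m' i : ℕ)) <| by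
        funext j
        exact congrArg PNat.val (congrFun (congrArg Subtype.val h) j)
      funext i
      exact PNat.eq (congrFun hval i)
    · obtain ⟨m, hm, hmN⟩ := exists_sum_Ici_eq (fun i => (N i : ℕ)) (fun i => (N i).pos)
        fun i j hij => hN i j hij
      refine ⟨fun i => ⟨m i, hm i⟩, Subtype.ext <| funext fun j => PNat.eq ?_⟩
      exact hmN j

theorem coe_suffixSumEquiv {k : ℕ} (m : Fin k → ℕ+) (j : Fin k) :
    (((suffixSumEquiv k m).1 j : ℕ+) : ℕ) = ∑ i ∈ Finset.Ici j, (m i : ℕ) :=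
  rfl

theorem tsum_suffixSumTerm {d : ℕ} (σ : Fin (d + 1) → Fin (d + 1)) (hσ : Function.Injective σ)
    (b : Fin (d + 1) → ℕ) : ∑' m, suffixSumTerm σ b m = MZV b := by
  let e := Equiv.ofBijective σ (Finite.injective_iff_bijective.mp hσ)
  rw [MZV, ← (suffixSumEquiv (d + 1)).tsum_eq, ← (e.arrowCongr (Equiv.refl ℕ+)).tsum_eq]
  refine tsum_congr fun m => ?_
  have hm (i) : e.arrowCongr (Equiv.refl ℕ+) m (σ i) = m i :=
    congrArg m (e.symm_apply_apply i)
  simp [suffixSumTerm, coe_suffixSumEquiv, hm]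

theorem summable_prod_pi {α : Type*} {f : α → ℝ} (hf : Summable f) (hnonneg : ∀ x, 0 ≤ f x)
    (k : ℕ) : Summable fun m : Fin k → α => ∏ j, f (m j) := by
  induction k with
  | zero => exact (hasSum_fintype _).summable
  | succ k ih =>
    rw [← (Fin.consEquiv fun _ : Fin (k + 1) => α).summable_iff]
    convert hf.mul_of_nonneg ih hnonneg fun m => Finset.prod_nonneg fun j _ => hnonneg (m j) using 1
    funext x
    simp [Fin.prod_univ_succ, Fin.consEquiv]

theorem summable_suffixSumTerm {d : ℕ} (σ : Fin (d + 1) → Fin (d + 1)) (hσ : Function.Injective σ)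
    (b : Fin (d + 1) → ℕ) (hb : ∀ j, 1 ≤ b j) (hb0 : 2 ≤ b 0) : Summable (suffixSumTerm σ b) := by
  let r : ℝ := 1 / ((d : ℝ) + 1)
  have hr : 0 < r := by positivity
  have hsummable : Summable fun n : ℕ+ => ((n : ℕ) : ℝ) ^ (-(1 + r)) :=
    (Real.summable_nat_rpow.mpr (by linarith)).comp_injective PNat.coe_injective
  refine Summable.of_nonneg_of_le (fun m => inv_nonneg.mpr <| Finset.prod_nonneg fun _ _ =>
    pow_nonneg (Finset.sum_nonneg fun _ _ => Nat.cast_nonneg _) _) (fun m => ?_)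
    (summable_prod_pi hsummable (fun n => by positivity) (d + 1))
  have hσ' : Function.Bijective σ := Finite.injective_iff_bijective.mp hσ
  rw [← hσ'.prod_comp fun j => ((m j : ℕ) : ℝ) ^ (-(1 + r))]
  simp_rw [fun n : ℕ+ => Real.rpow_neg (cast_pnat_pos n).le (1 + r)]
  rw [Finset.prod_inv_distrib, suffixSumTerm]
  set x : Fin (d + 1) → ℝ := fun i => ((m (σ i) : ℕ) : ℝ)
  have hx (i) : 1 ≤ x i := Nat.one_le_cast.mpr (m (σ i)).pos
  have hx0 (i) : 0 ≤ x i := zero_le_one.trans (hx i)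
  set N : Fin (d + 1) → ℝ := fun j => ∑ i ∈ Finset.Ici j, x i
  have hxN (i j) (h : j ≤ i) : x i ≤ N j :=
    Finset.single_le_sum (f := x) (fun i _ => hx0 i) (Finset.mem_Ici.mpr h)
  have hN (j) : 1 ≤ N j := (hx j).trans (hxN j j le_rfl)
  have hprod : 0 < ∏ j, x j ^ (1 + r) :=
    Finset.prod_pos fun j _ => Real.rpow_pos_of_pos (zero_lt_one.trans_le (hx j)) _
  refine inv_anti₀ hprod ?_
  have hroot : ∏ j, x j ^ r ≤ N 0 := by
    calc ∏ j, x j ^ r ≤ ∏ _j : Fin (d + 1), N 0 ^ r :=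
          Finset.prod_le_prod (fun j _ => Real.rpow_nonneg (hx0 j) _) fun j _ =>
            Real.rpow_le_rpow (hx0 j) (hxN j 0 (Fin.zero_le j)) hr.le
      _ = N 0 := by
          rw [Finset.prod_const, Finset.card_univ, Fintype.card_fin, ← Real.rpow_natCast,
            ← Real.rpow_mul (zero_le_one.trans (hN 0))]
          have : r * ((d + 1 : ℕ) : ℝ) = 1 := by
            simp only [r]
            push_cast
            field_simp
          rw [this, Real.rpow_one]
  calc ∏ j, x j ^ (1 + r) = (∏ j, x j ^ r) * ∏ j, x j := by
        rw [← Finset.prod_mul_distrib]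
        refine Finset.prod_congr rfl fun j _ => ?_
        rw [Real.rpow_add (zero_lt_one.trans_le (hx j)), Real.rpow_one, mul_comm]
    _ ≤ N 0 * ∏ j, N j :=
        mul_le_mul hroot (Finset.prod_le_prod (fun j _ => hx0 j) fun j _ => hxN j j le_rfl)
          (Finset.prod_nonneg fun j _ => hx0 j) (zero_le_one.trans (hN 0))
    _ = N 0 ^ 2 * ∏ j : Fin d, N j.succ := by
        rw [Fin.prod_univ_succ]
        ring
    _ ≤ N 0 ^ b 0 * ∏ j : Fin d, N j.succ ^ b j.succ := by
        refine mul_le_mul (pow_le_pow_right₀ (hN 0) hb0) (Finset.prod_le_prod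
          (fun j _ => zero_le_one.trans (hN _)) fun j _ => ?_)
          (Finset.prod_nonneg fun j _ => zero_le_one.trans (hN _))
          (pow_nonneg (zero_le_one.trans (hN 0)) _)
        exact le_self_pow₀ (hN _) (Nat.one_le_iff_ne_zero.mp (hb _))
    _ = ∏ j, N j ^ b j := (Fin.prod_univ_succ fun j => N j ^ b j).symm

theorem summable_and_tsum_mem_span {d : ℕ} {f : (Fin (d + 1) → ℕ+) → ℝ}
    (hf : f ∈ suffixSumCombinations (d + 1) 2) :
    Summable f ∧ ∑' m, f m ∈ Submodule.span ℚ (admissibleMZVs d) := by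
  induction hf using AddSubmonoid.closure_induction with
  | mem f hf =>
    obtain ⟨σ, b, hσ, hb, hb0, rfl⟩ := hf
    refine ⟨summable_suffixSumTerm σ hσ b hb (hb0 0 rfl), Submodule.subset_span ?_⟩
    exact ⟨b, hb0 0 rfl, hb, tsum_suffixSumTerm σ hσ b⟩
  | zero => exact ⟨summable_zero, by simp⟩
  | add f g _ _ hf hg =>
    refine ⟨hf.1.add hg.1, ?_⟩
    simpa only [Pi.add_apply, hf.1.tsum_add hg.1] using add_mem hf.2 hg.2

theorem MTZ_mem_span {d : ℕ} (s : Fin (d + 2) → ℕ) (hs : ∀ j, 1 ≤ s j) :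
    MTZ s ∈ Submodule.span ℚ (admissibleMZVs d) :=
  (summable_and_tsum_mem_span <| mordellTornheimTerm_mem_of_depth_pred
    inv_prod_pow_mem_suffixSumCombinations (fun j => s j.castSucc) (fun _ => hs _)
      (s (Fin.last (d + 1))) (Nat.succ_le_succ (hs _))).2


theorem stmt0 (k : ℕ) (hk : 2 ≤ k) (s : Fin (k + 1) → ℕ) (hs : ∀ j, 1 ≤ s j) :
    ∃ (M : ℕ) (c : Fin M → ℚ) (T : Fin M → List ((d : ℕ) × (Fin (d + 1) → ℕ))),
      (∀ m : Fin M, T m ≠ [] ∧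
        ∀ p ∈ T m, p.1 + 1 ≤ k ∧ 2 ≤ p.2 0 ∧ (∀ i, 1 ≤ p.2 i)) ∧
      ∑ j : Fin (k + 1), (-1 : ℝ) ^ s j * MTZ (s ∘ Equiv.swap j (Fin.last k))
        = ∑ m : Fin M, (c m : ℝ) * ((T m).map fun p => MZV p.2).prod := by
  obtain ⟨d, rfl⟩ : ∃ d, k = d + 1 := ⟨k - 1, by omega⟩
  have hmem : ∑ j, (-1 : ℝ) ^ s j * MTZ (s ∘ Equiv.swap j (Fin.last (d + 1))) ∈
      Submodule.span ℚ (admissibleMZVs d) := by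
    refine sum_mem fun j _ => ?_
    have h := Submodule.smul_mem _ ((-1 : ℚ) ^ s j)
      (MTZ_mem_span (s ∘ Equiv.swap j (Fin.last (d + 1))) fun i => hs _)
    simpa [Rat.smul_def] using h
  obtain ⟨M, c, g, hg⟩ := Submodule.mem_span_set'.mp hmem
  choose n hn0 hn hgn using fun i => (g i).2
  refine ⟨M, c, fun m => [⟨d, n m⟩], fun m => ⟨List.cons_ne_nil _ _, ?_⟩, ?_⟩
  · intro p hp
    obtain rfl := List.mem_singleton.mp hp
    exact ⟨le_rfl, hn0 m, hn m⟩
  · rw [← hg]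
    simp [Rat.smul_def, hgn]
end

section
/- Let n be a positive integer and k ≥ 2 an integer. Then the Mordell–Tornheim zeta value ζ_MT(n,n,…,n) with n repeated k+1 times is reducible: there exist finitely many rational numbers c_1,…,c_M and, for each m, a finite nonempty list of Mordell–Tornheim zeta values, each of the form ζ_MT(t_1,…,t_{d+1}) with positive integer arguments and depth d ≤ k−1, such that ζ_MT(n,…,n) (k+1 copies) equals Σ_{m=1}^M c_m × (the product of the Mordell–Tornheim zeta values in the m-th list). -/
open Filter Topology MeasureTheory

section ProductSeries

/-- The `b`-th power of an absolutely convergent series, expanded as a series over `Fin b → ι`. -/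
theorem summable_norm_prod_and_tsum_pow {ι 𝕜 : Type*} [RCLike 𝕜] {f : ι → 𝕜}
    (hf : Summable fun x => ‖f x‖) (b : ℕ) :
    (Summable fun m : Fin b → ι => ‖∏ j, f (m j)‖) ∧
      ∑' m : Fin b → ι, ∏ j, f (m j) = (∑' x, f x) ^ b := by
  induction b with
  | zero => exact ⟨(hasSum_fintype _).summable, by simp⟩
  | succ b ih =>
    have h (p : ι × (Fin b → ι)) :
        ∏ j, f (Fin.consEquiv (fun _ => ι) p j) = f p.1 * ∏ j, f (p.2 j) := by
      simp [Fin.consEquiv, Fin.prod_univ_succ]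
    constructor
    · rw [← (Fin.consEquiv fun _ => ι).summable_iff]
      refine (hf.mul_norm ih.1).congr fun p => ?_
      rw [Function.comp_apply, h]
    · rw [← (Fin.consEquiv fun _ => ι).tsum_eq, pow_succ', ← ih.2,
        tsum_mul_tsum_of_summable_norm hf ih.1]
      exact tsum_congr h

theorem prod_le_sum_pow {b : ℕ} (m : Fin b → ℕ+) :
    ∏ j, ((m j : ℕ) : ℝ) ≤ (∑ j, ((m j : ℕ) : ℝ)) ^ b := by
  calc ∏ j, ((m j : ℕ) : ℝ) ≤ ∏ _j : Fin b, ∑ i, ((m i : ℕ) : ℝ) :=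
        Finset.prod_le_prod (fun _ _ => by positivity) fun j hj =>
          Finset.single_le_sum (f := fun i => ((m i : ℕ) : ℝ)) (fun _ _ => by positivity) hj
    _ = _ := by simp

theorem one_le_sum_pnat {b : ℕ} (hb : b ≠ 0) (m : Fin b → ℕ+) :
    (1 : ℝ) ≤ ∑ j, ((m j : ℕ) : ℝ) := by
  have : NeZero b := ⟨hb⟩
  refine le_trans ?_ (Finset.single_le_sum (f := fun i => ((m i : ℕ) : ℝ))
    (fun _ _ => by positivity) (Finset.mem_univ 0))
  exact_mod_cast (m 0).pos

/-- Absolute convergence of the Mordell–Tornheim series with positive arguments. -/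
theorem summable_mordellTornheim {n r b : ℕ} (hn : 1 ≤ n) (hr : 1 ≤ r) (hb : b ≠ 0) :
    Summable fun m : Fin b → ℕ+ =>
      (∏ j, ((m j : ℕ) : ℝ) ^ n)⁻¹ * ((∑ j, ((m j : ℕ) : ℝ)) ^ r)⁻¹ := by
  have hb' : (0 : ℝ) < b := by positivity
  have hf : Summable fun x : ℕ+ => ‖((x : ℕ) : ℝ) ^ (-(1 + 1 / (b : ℝ)))‖ := by
    have : Summable fun x : ℕ => ((x : ℕ) : ℝ) ^ (-(1 + 1 / (b : ℝ))) :=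
      Real.summable_nat_rpow.2 (by have := one_div_pos.2 hb'; linarith)
    exact (this.comp_injective PNat.coe_injective).norm
  refine Summable.of_nonneg_of_le (fun m => by positivity) (fun m => ?_)
    (summable_norm_prod_and_tsum_pow hf b).1
  have hS := one_le_sum_pnat hb m
  have hP : (0 : ℝ) < ∏ j, ((m j : ℕ) : ℝ) :=
    Finset.prod_pos fun j _ => by exact_mod_cast (m j).pos
  have hP1 : (1 : ℝ) ≤ ∏ j, ((m j : ℕ) : ℝ) :=
    Finset.one_le_prod fun j _ => by exact_mod_cast (m j).pos
  have h1 : ‖∏ j, ((m j : ℕ) : ℝ) ^ (-(1 + 1 / (b : ℝ)))‖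
      = (∏ j, ((m j : ℕ) : ℝ))⁻¹ * ((∏ j, ((m j : ℕ) : ℝ)) ^ (1 / (b : ℝ)))⁻¹ := by
    rw [Real.finsetProd_rpow _ _ fun _ _ => by positivity, Real.norm_of_nonneg (by positivity),
      Real.rpow_neg hP.le, Real.rpow_add hP, Real.rpow_one, mul_inv]
  rw [h1, Finset.prod_pow]
  have h2 : (∏ j, ((m j : ℕ) : ℝ)) ^ (1 / (b : ℝ)) ≤ ∑ j, ((m j : ℕ) : ℝ) := by
    rw [one_div, Real.rpow_inv_le_iff_of_pos hP.le (by positivity) hb', Real.rpow_natCast]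
    exact prod_le_sum_pow m
  gcongr
  · exact le_self_pow₀ hP1 (by omega)
  · exact h2.trans (le_self_pow₀ hS (by omega))

end ProductSeries

section ReducibleSpan

/-- The rational span of nonempty products of Mordell–Tornheim zeta values with positive arguments
and depth at most `K`. -/
noncomputable def reducibleSpan (K : ℕ) : Submodule ℚ ℝ :=
  Submodule.span ℚ {x | ∃ T : List ((d : ℕ) × (Fin (d + 1) → ℕ)), T ≠ [] ∧
    (∀ p ∈ T, 1 ≤ p.1 ∧ p.1 ≤ K ∧ ∀ i, 1 ≤ p.2 i) ∧ x = (T.map fun p => MTZ p.2).prod}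

theorem exists_sum_of_mem_reducibleSpan {K : ℕ} {x : ℝ} (hx : x ∈ reducibleSpan K) :
    ∃ (M : ℕ) (c : Fin M → ℚ) (T : Fin M → List ((d : ℕ) × (Fin (d + 1) → ℕ))),
      (∀ m : Fin M, T m ≠ [] ∧
        ∀ p ∈ T m, 1 ≤ p.1 ∧ p.1 ≤ K ∧ (∀ i, 1 ≤ p.2 i)) ∧
      x = ∑ m : Fin M, (c m : ℝ) * ((T m).map fun p => MTZ p.2).prod := by
  obtain ⟨M, c, g, hg⟩ := (Submodule.mem_span_set' (M := ℝ)).1 hx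
  choose T hT using fun m => (g m).2
  refine ⟨M, c, T, fun m => ⟨(hT m).1, (hT m).2.1⟩, ?_⟩
  rw [← hg]
  refine Finset.sum_congr rfl fun m _ => ?_
  rw [Rat.smul_def, (hT m).2.2]

theorem hasSum_pnat_iff_of_zero {E : Type*} [AddCommGroup E] [TopologicalSpace E]
    [IsTopologicalAddGroup E] {f : ℕ → E} {a : E} (hf : f 0 = 0) :
    HasSum (fun x : ℕ+ => f x) a ↔ HasSum f a := by
  rw [hasSum_pnat_iff, hf, add_zero]

theorem MTZ_one_one : MTZ (fun _ : Fin 2 => 1) = Real.pi ^ 2 / 6 := by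
  rw [← hasSum_zeta_two.tsum_eq, MTZ, ← (Equiv.funUnique (Fin 1) ℕ+).symm.tsum_eq,
    ← ((hasSum_pnat_iff_of_zero (f := fun n : ℕ => (1 : ℝ) / (n : ℝ) ^ 2) (by simp)).2
      hasSum_zeta_two.summable.hasSum).tsum_eq]
  refine tsum_congr fun m => ?_
  simp [sq]

theorem two_pi_I_pow_even (i : ℕ) :
    (2 * Real.pi * Complex.I) ^ (2 * i) =
      (((-24 : ℚ) ^ i : ℚ) * MTZ (fun _ : Fin 2 => 1) ^ i : ℝ) := by
  rw [MTZ_one_one, pow_mul]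
  push_cast
  rw [← mul_pow]
  congr 1
  linear_combination (4 * (Real.pi : ℂ) ^ 2) * Complex.I_sq

theorem two_pi_I_pow_odd_re (i : ℕ) : ((2 * Real.pi * Complex.I) ^ (2 * i + 1)).re = 0 := by
  rw [pow_succ, two_pi_I_pow_even, Complex.re_ofReal_mul]
  simp

theorem re_two_pi_I_pow_mem {K : ℕ} (hK : 1 ≤ K) {j : ℕ} (hj : 1 ≤ j) :
    ((2 * Real.pi * Complex.I) ^ j).re ∈ reducibleSpan K := by
  obtain ⟨i, rfl | rfl⟩ := j.even_or_odd'
  · rw [two_pi_I_pow_even, Complex.ofReal_re, ← Rat.smul_def]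
    refine Submodule.smul_mem _ _ (Submodule.subset_span
      ⟨List.replicate i ⟨1, fun _ => 1⟩, ?_, ?_, by simp⟩)
    · simpa using (by omega : i ≠ 0)
    · intro p hp
      rw [List.eq_of_mem_replicate hp]
      exact ⟨le_rfl, hK, fun _ => le_rfl⟩
  · rw [two_pi_I_pow_odd_re]
    exact zero_mem _

theorem re_two_pi_I_pow_mul_MTZ_mem {K b : ℕ} (hb : 1 ≤ b) (hbK : b ≤ K) (j : ℕ)
    {s : Fin (b + 1) → ℕ} (hs : ∀ i, 1 ≤ s i) :
    ((2 * Real.pi * Complex.I) ^ j * (MTZ s : ℂ)).re ∈ reducibleSpan K := by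
  rw [Complex.re_mul_ofReal]
  obtain ⟨i, rfl | rfl⟩ := j.even_or_odd'
  · rw [two_pi_I_pow_even, Complex.ofReal_re, mul_assoc, ← Rat.smul_def]
    refine Submodule.smul_mem _ _ (Submodule.subset_span
      ⟨List.replicate i ⟨1, fun _ => 1⟩ ++ [⟨b, s⟩], by simp, ?_, by simp⟩)
    intro p hp
    rcases List.mem_append.1 hp with hp | hp
    · rw [List.eq_of_mem_replicate hp]
      exact ⟨le_rfl, hb.trans hbK, fun _ => le_rfl⟩
    · rw [List.mem_singleton.1 hp]
      exact ⟨hb, hbK, hs⟩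
  · rw [two_pi_I_pow_odd_re, zero_mul]
    exact zero_mem _

end ReducibleSpan

section Polylog

/-- The polylogarithm series `∑ wˣ / xⁿ`. -/
noncomputable def polylogSeries (n : ℕ) (w : ℂ) : ℂ :=
  ∑' x : ℕ+, w ^ (x : ℕ) / ((x : ℕ) : ℂ) ^ n

/-- The standard character `θ ↦ exp (2πiθ)`. -/
noncomputable def unitExp (θ : ℝ) : ℂ := Complex.exp (2 * Real.pi * Complex.I * θ)

theorem norm_unitExp (θ : ℝ) : ‖unitExp θ‖ = 1 := by
  rw [unitExp, Complex.norm_exp]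
  simp

@[fun_prop]
theorem continuous_unitExp : Continuous unitExp := by
  unfold unitExp
  fun_prop

theorem norm_ofReal_mul_unitExp {ρ : ℝ} (hρ : 0 ≤ ρ) (θ : ℝ) : ‖(ρ : ℂ) * unitExp θ‖ = ρ := by
  rw [norm_mul, norm_unitExp, mul_one, Complex.norm_of_nonneg hρ]

theorem norm_polylog_term_le (n : ℕ) (w : ℂ) (x : ℕ+) :
    ‖w ^ (x : ℕ) / ((x : ℕ) : ℂ) ^ n‖ ≤ ‖w‖ ^ (x : ℕ) := by
  rw [norm_div, norm_pow, norm_pow, Complex.norm_natCast]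
  exact div_le_self (by positivity) (one_le_pow₀ (by exact_mod_cast x.pos))

theorem summable_pow_pnat {ρ : ℝ} (h0 : 0 ≤ ρ) (h1 : ρ < 1) :
    Summable fun x : ℕ+ => ρ ^ (x : ℕ) :=
  (summable_geometric_of_lt_one h0 h1).comp_injective PNat.coe_injective

theorem summable_norm_polylog (n : ℕ) {w : ℂ} (hw : ‖w‖ < 1) :
    Summable fun x : ℕ+ => ‖w ^ (x : ℕ) / ((x : ℕ) : ℂ) ^ n‖ :=
  (summable_pow_pnat (norm_nonneg w) hw).of_nonneg_of_le (fun _ => norm_nonneg _)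
    (norm_polylog_term_le n w)

theorem prod_polylog_term (n : ℕ) (w : ℂ) {b : ℕ} (m : Fin b → ℕ+) :
    ∏ j, w ^ (m j : ℕ) / ((m j : ℕ) : ℂ) ^ n
      = (∏ j, ((m j : ℕ) : ℂ) ^ n)⁻¹ * w ^ ∑ j, (m j : ℕ) := by
  rw [Finset.prod_div_distrib, Finset.prod_pow_eq_pow_sum, div_eq_inv_mul]

theorem summable_norm_polylog_pow (n b : ℕ) {w : ℂ} (hw : ‖w‖ < 1) :
    Summable fun m : Fin b → ℕ+ => ‖(∏ j, ((m j : ℕ) : ℂ) ^ n)⁻¹ * w ^ ∑ j, (m j : ℕ)‖ := by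
  simpa only [prod_polylog_term] using
    (summable_norm_prod_and_tsum_pow (summable_norm_polylog n hw) b).1

theorem hasSum_polylog_pow (n b : ℕ) {w : ℂ} (hw : ‖w‖ < 1) :
    HasSum (fun m : Fin b → ℕ+ => (∏ j, ((m j : ℕ) : ℂ) ^ n)⁻¹ * w ^ ∑ j, (m j : ℕ))
      (polylogSeries n w ^ b) := by
  have := (summable_norm_prod_and_tsum_pow (summable_norm_polylog n hw) b).2
  simp only [prod_polylog_term] at this
  rw [polylogSeries, ← this]
  exact (summable_norm_polylog_pow n b hw).of_norm.hasSum

theorem continuous_polylog_circle (n : ℕ) {ρ : ℝ} (h0 : 0 ≤ ρ) (h1 : ρ < 1) :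
    Continuous fun θ => polylogSeries n (ρ * unitExp θ) := by
  refine continuous_tsum (fun x => by fun_prop) (summable_pow_pnat h0 h1) fun x θ => ?_
  refine (norm_polylog_term_le n _ x).trans_eq ?_
  rw [norm_ofReal_mul_unitExp h0]

theorem hasSum_integral_mul_polylog_pow (n b : ℕ) {ρ : ℝ} (h0 : 0 ≤ ρ) (h1 : ρ < 1) {f : ℝ → ℂ}
    (hf : Continuous f) :
    HasSum (fun m : Fin b → ℕ+ => (∏ j, ((m j : ℕ) : ℂ) ^ n)⁻¹ * ρ ^ (∑ j, (m j : ℕ)) *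
        ∫ θ in (0 : ℝ)..1, f θ * unitExp θ ^ (∑ j, (m j : ℕ)))
      (∫ θ in (0 : ℝ)..1, f θ * polylogSeries n (ρ * unitExp θ) ^ b) := by
  obtain ⟨C, hC⟩ := (isCompact_uIcc (a := (0 : ℝ)) (b := 1)).exists_bound_of_continuousOn
    hf.continuousOn
  have hρ : ‖(ρ : ℂ)‖ < 1 := by rwa [Complex.norm_of_nonneg h0]
  have key := intervalIntegral.hasSum_integral_of_dominated_convergence (μ := volume)
    (a := (0 : ℝ)) (b := 1)
    (F := fun (m : Fin b → ℕ+) θ =>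
      f θ * ((∏ j, ((m j : ℕ) : ℂ) ^ n)⁻¹ * (ρ * unitExp θ) ^ ∑ j, (m j : ℕ)))
    (f := fun θ => f θ * polylogSeries n (ρ * unitExp θ) ^ b)
    (fun m _ => C * ‖(∏ j, ((m j : ℕ) : ℂ) ^ n)⁻¹ * (ρ : ℂ) ^ ∑ j, (m j : ℕ)‖)
    (fun m => (by fun_prop : Continuous _).aestronglyMeasurable)
    (fun m => Eventually.of_forall fun θ hθ => ?_)
    (Eventually.of_forall fun θ _ => (summable_norm_polylog_pow n b hρ).mul_left C)
    intervalIntegrable_const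
    (Eventually.of_forall fun θ _ => (hasSum_polylog_pow n b ?_).mul_left _)
  · convert! key using 2 with m
    rw [← intervalIntegral.integral_const_mul]
    refine intervalIntegral.integral_congr fun θ _ => ?_
    simp only [mul_pow]
    ring
  · rw [norm_mul, mul_pow, ← mul_assoc, norm_mul _ (unitExp θ ^ _), norm_pow (unitExp θ),
      norm_unitExp, one_pow, mul_one]
    gcongr
    exact hC θ (Set.uIoc_subset_uIcc hθ)
  · rwa [norm_ofReal_mul_unitExp h0]

theorem integral_bernoulliFun_mul_unitExp_pow (r : ℕ) {N : ℕ} (hN : N ≠ 0) :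
    ∫ θ in (0 : ℝ)..1, (bernoulliFun r θ : ℂ) * unitExp θ ^ N
      = if r = 0 then 0 else -(r.factorial : ℂ) / (-(2 * Real.pi * Complex.I)) ^ r
          * ((N : ℂ) ^ r)⁻¹ := by
  have h : ∫ θ in (0 : ℝ)..1, (bernoulliFun r θ : ℂ) * unitExp θ ^ N
      = bernoulliFourierCoeff r (-N) := by
    rw [bernoulliFourierCoeff, fourierCoeffOn_eq_integral]
    simp only [sub_zero, one_div, inv_one, one_smul, neg_neg]
    refine intervalIntegral.integral_congr fun θ _ => ?_
    simp only [smul_eq_mul, fourier_coe_apply, unitExp, ← Complex.exp_nat_mul]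
    rw [mul_comm]
    congr 2
    push_cast
    ring
  rw [h]
  split_ifs with hr
  · rw [hr, bernoulli_zero_fourier_coeff (by simpa using hN)]
  · rw [bernoulliFourierCoeff_eq hr, ← div_eq_mul_inv, div_div, ← mul_pow]
    push_cast
    congr 2
    ring

/-- The Abel limit of the moments of a power of the polylogarithm against a Bernoulli polynomial is
a Mordell–Tornheim zeta value. -/
theorem tendsto_integral_bernoulliFun_mul_polylog_pow {n r b : ℕ} (hn : 1 ≤ n) (hr : 1 ≤ r)
    (hb : b ≠ 0) :
    Tendsto (fun ρ : ℝ => ∫ θ in (0 : ℝ)..1,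
        (bernoulliFun r θ : ℂ) * polylogSeries n (ρ * unitExp θ) ^ b) (𝓝[<] 1)
      (𝓝 (-(r.factorial : ℂ) / (-(2 * Real.pi * Complex.I)) ^ r *
        (MTZ (Fin.snoc (α := fun _ => ℕ) (fun _ : Fin b => n) r) : ℂ))) := by
  set A : ℂ := -(r.factorial : ℂ) / (-(2 * Real.pi * Complex.I)) ^ r with hA
  have hS (m : Fin b → ℕ+) : (∑ j, (m j : ℕ)) ≠ 0 := by
    have := one_le_sum_pnat hb m
    intro h
    rw [← Nat.cast_sum, h] at this
    norm_num at this
  have hev : ∀ᶠ ρ : ℝ in 𝓝[<] 1, 0 ≤ ρ ∧ ρ < 1 := by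
    filter_upwards [Ioo_mem_nhdsLT (zero_lt_one' ℝ)] with ρ h using ⟨h.1.le, h.2⟩
  have hterm (m : Fin b → ℕ+) : ‖(((∏ j, ((m j : ℕ) : ℝ) ^ n)⁻¹ *
      ((∑ j, ((m j : ℕ) : ℝ)) ^ r)⁻¹ : ℝ) : ℂ)‖ = (∏ j, ((m j : ℕ) : ℝ) ^ n)⁻¹ *
      ((∑ j, ((m j : ℕ) : ℝ)) ^ r)⁻¹ := Complex.norm_of_nonneg (by positivity)
  have hlim := tendsto_tsum_of_dominated_convergence (𝓕 := 𝓝[<] (1 : ℝ))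
    (f := fun ρ (m : Fin b → ℕ+) => (ρ : ℂ) ^ (∑ j, (m j : ℕ)) * (A *
      (((∏ j, ((m j : ℕ) : ℝ) ^ n)⁻¹ * ((∑ j, ((m j : ℕ) : ℝ)) ^ r)⁻¹ : ℝ) : ℂ)))
    (g := fun m => 1 * (A *
      (((∏ j, ((m j : ℕ) : ℝ) ^ n)⁻¹ * ((∑ j, ((m j : ℕ) : ℝ)) ^ r)⁻¹ : ℝ) : ℂ)))
    ((summable_mordellTornheim hn hr hb).mul_left ‖A‖)
    (fun m => Tendsto.mul_const _ ?_) ?_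
  · simp only [one_mul] at hlim
    rw [tsum_mul_left, ← Complex.ofReal_tsum] at hlim
    simp only [MTZ, Fin.snoc_castSucc, Fin.snoc_last]
    refine hlim.congr' ?_
    filter_upwards [hev] with ρ hρ
    rw [← (hasSum_integral_mul_polylog_pow n b hρ.1 hρ.2
      (by fun_prop : Continuous fun θ => (bernoulliFun r θ : ℂ))).tsum_eq]
    refine tsum_congr fun m => ?_
    rw [integral_bernoulliFun_mul_unitExp_pow r (hS m), if_neg (by omega), ← hA]
    push_cast
    ring
  · have : Continuous fun ρ : ℝ => (ρ : ℂ) ^ (∑ j, (m j : ℕ)) := by fun_prop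
    simpa using (this.tendsto 1).mono_left nhdsWithin_le_nhds
  · filter_upwards [hev] with ρ hρ m
    rw [norm_mul, norm_mul, hterm, norm_pow, Complex.norm_of_nonneg hρ.1]
    exact mul_le_of_le_one_left (by positivity) (pow_le_one₀ hρ.1 hρ.2.le)

theorem integral_polylog_pow {n b : ℕ} (hb : b ≠ 0) {ρ : ℝ} (h0 : 0 ≤ ρ) (h1 : ρ < 1) :
    ∫ θ in (0 : ℝ)..1, polylogSeries n (ρ * unitExp θ) ^ b = 0 := by
  have h := hasSum_integral_mul_polylog_pow n b h0 h1 (continuous_const (y := (1 : ℂ)))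
  simp only [one_mul] at h
  rw [← h.tsum_eq]
  refine (tsum_congr fun m => ?_).trans tsum_zero
  have hS : (∑ j, (m j : ℕ)) ≠ 0 := by
    have := one_le_sum_pnat hb m
    intro h
    rw [← Nat.cast_sum, h] at this
    norm_num at this
  simpa using Or.inr (integral_bernoulliFun_mul_unitExp_pow 0 hS)

end Polylog

section RadialLimit

theorem one_sub_unitExp (θ : ℝ) :
    1 - unitExp θ = ((2 * Real.sin (Real.pi * θ) : ℝ) : ℂ) *
      (Complex.cos ((Real.pi * θ - Real.pi / 2 : ℝ) : ℂ) +
        Complex.sin ((Real.pi * θ - Real.pi / 2 : ℝ) : ℂ) * Complex.I) := by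
  rw [← Complex.ofReal_cos, ← Complex.ofReal_sin, Real.cos_sub_pi_div_two,
    Real.sin_sub_pi_div_two, unitExp,
    show 2 * (Real.pi : ℂ) * Complex.I * θ = ((2 * (Real.pi * θ) : ℝ) : ℂ) * Complex.I by
      push_cast; ring,
    Complex.exp_mul_I, ← Complex.ofReal_cos, ← Complex.ofReal_sin, Real.cos_two_mul,
    Real.sin_two_mul]
  have h := Real.sin_sq_add_cos_sq (Real.pi * θ)
  have h' : ((Real.sin (Real.pi * θ) : ℝ) : ℂ) ^ 2 + ((Real.cos (Real.pi * θ) : ℝ) : ℂ) ^ 2 = 1 := by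
    exact_mod_cast h
  push_cast at h' ⊢
  linear_combination (-2) * h'

theorem sin_pi_mul_pos {θ : ℝ} (hθ : θ ∈ Set.Ioo (0 : ℝ) 1) : 0 < Real.sin (Real.pi * θ) :=
  Real.sin_pos_of_pos_of_lt_pi (mul_pos Real.pi_pos hθ.1)
    (by nlinarith [Real.pi_pos, hθ.2])

theorem mul_one_sub_le_sin {θ : ℝ} (hθ : θ ∈ Set.Ioo (0 : ℝ) 1) :
    θ * (1 - θ) ≤ Real.sin (Real.pi * θ) := by
  have hπ := Real.pi_pos
  rcases le_total θ (1 / 2) with h | h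
  · have := Real.mul_le_sin (x := Real.pi * θ) (by nlinarith [hθ.1]) (by nlinarith)
    rw [show 2 / Real.pi * (Real.pi * θ) = 2 * θ by field_simp] at this
    nlinarith [hθ.1, hθ.2]
  · have := Real.mul_le_sin (x := Real.pi * (1 - θ)) (by nlinarith [hθ.2]) (by nlinarith)
    rw [show 2 / Real.pi * (Real.pi * (1 - θ)) = 2 * (1 - θ) by field_simp,
      show Real.pi * (1 - θ) = Real.pi - Real.pi * θ by ring, Real.sin_pi_sub] at this
    nlinarith [hθ.1, hθ.2]

theorem norm_one_sub_unitExp {θ : ℝ} (hθ : θ ∈ Set.Ioo (0 : ℝ) 1) :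
    ‖1 - unitExp θ‖ = 2 * Real.sin (Real.pi * θ) := by
  have h := sin_pi_mul_pos hθ
  rw [one_sub_unitExp, norm_mul, Complex.norm_of_nonneg (by positivity),
    Complex.norm_cos_add_sin_mul_I, mul_one]

theorem arg_one_sub_unitExp {θ : ℝ} (hθ : θ ∈ Set.Ioo (0 : ℝ) 1) :
    (1 - unitExp θ).arg = Real.pi * θ - Real.pi / 2 := by
  have h := sin_pi_mul_pos hθ
  have hπ := Real.pi_pos
  rw [one_sub_unitExp, Complex.arg_mul_cos_add_sin_mul_I (by positivity)]
  constructor <;> nlinarith [hθ.1, hθ.2]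

theorem polylogSeries_one {w : ℂ} (hw : ‖w‖ < 1) : polylogSeries 1 w = -Complex.log (1 - w) := by
  simp only [polylogSeries, pow_one]
  exact ((hasSum_pnat_iff_of_zero (f := fun x : ℕ => w ^ x / (x : ℂ)) (by simp)).2
    (Complex.hasSum_taylorSeries_neg_log hw)).tsum_eq

theorem summable_pnat_inv_pow {n : ℕ} (hn : 2 ≤ n) :
    Summable fun x : ℕ+ => (((x : ℕ) : ℝ) ^ n)⁻¹ :=
  (Real.summable_nat_pow_inv.2 hn).comp_injective PNat.coe_injective

theorem norm_polylog_term_le_inv_pow (n : ℕ) {w : ℂ} (hw : ‖w‖ ≤ 1) (x : ℕ+) :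
    ‖w ^ (x : ℕ) / ((x : ℕ) : ℂ) ^ n‖ ≤ (((x : ℕ) : ℝ) ^ n)⁻¹ := by
  rw [norm_div, norm_pow, norm_pow, Complex.norm_natCast, div_eq_mul_inv]
  exact mul_le_of_le_one_left (by positivity) (pow_le_one₀ (norm_nonneg _) hw)

theorem eventually_mem_Ico_zero_one : ∀ᶠ ρ : ℝ in 𝓝[<] 1, 0 ≤ ρ ∧ ρ < 1 := by
  filter_upwards [Ioo_mem_nhdsLT (zero_lt_one' ℝ)] with ρ h using ⟨h.1.le, h.2⟩

theorem polylogSeries_unitExp_add_conj {n : ℕ} (hn : 2 ≤ n) {θ : ℝ}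
    (hθ : θ ∈ Set.Icc (0 : ℝ) 1) :
    polylogSeries n (unitExp θ) + (-1) ^ n * starRingEnd ℂ (polylogSeries n (unitExp θ)) =
      -(2 * Real.pi * Complex.I) ^ n / n.factorial * bernoulliFun n θ := by
  have hs : Summable fun x : ℕ+ => unitExp θ ^ (x : ℕ) / ((x : ℕ) : ℂ) ^ n :=
    Summable.of_norm_bounded (summable_pnat_inv_pow hn)
      (norm_polylog_term_le_inv_pow n (norm_unitExp θ).le)
  have h1 := hs.hasSum.add ((Complex.hasSum_conj'.2 hs.hasSum).mul_left ((-1) ^ n))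
  refine h1.unique ?_
  convert! (hasSum_pnat_iff_of_zero (by simp; omega)).2
    (hasSum_one_div_nat_pow_mul_fourier hn hθ) using 2 with x
  have hc : starRingEnd ℂ (unitExp θ) = Complex.exp (-(2 * Real.pi * Complex.I * θ)) := by
    rw [unitExp, ← Complex.exp_conj]
    simp [Complex.conj_ofNat]
  simp only [fourier_coe_apply, map_div₀, map_pow, hc, Complex.conj_natCast]
  rw [unitExp, ← Complex.exp_nat_mul, ← Complex.exp_nat_mul]
  push_cast
  rw [show 2 * Real.pi * Complex.I * ((x : ℕ) : ℂ) * θ / 1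
      = ((x : ℕ) : ℂ) * (2 * Real.pi * Complex.I * θ) by ring,
    show 2 * Real.pi * Complex.I * -((x : ℕ) : ℂ) * θ / 1
      = ((x : ℕ) : ℂ) * -(2 * Real.pi * Complex.I * θ) by ring]
  ring

/-- Radial limits of the polylogarithm, whose (anti)symmetrisation is a Bernoulli polynomial. -/
theorem exists_tendsto_polylogSeries {n : ℕ} (hn : 1 ≤ n) {θ : ℝ} (hθ : θ ∈ Set.Ioo (0 : ℝ) 1) :
    ∃ l : ℂ, Tendsto (fun ρ : ℝ => polylogSeries n (ρ * unitExp θ)) (𝓝[<] 1) (𝓝 l) ∧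
      l + (-1) ^ n * starRingEnd ℂ l =
        -(2 * Real.pi * Complex.I) ^ n / n.factorial * bernoulliFun n θ := by
  rcases hn.eq_or_lt with rfl | hn
  · have hre : 0 < (1 - unitExp θ).re := by
      have h : |(1 - unitExp θ).arg| < Real.pi / 2 := by
        rw [arg_one_sub_unitExp hθ, abs_lt]
        have hπ := Real.pi_pos
        constructor <;> nlinarith [hθ.1, hθ.2]
      refine (Complex.abs_arg_lt_pi_div_two_iff.1 h).resolve_right fun h0 => ?_
      have := norm_one_sub_unitExp hθ
      rw [h0, norm_zero] at this
      linarith [sin_pi_mul_pos hθ]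
    refine ⟨-Complex.log (1 - unitExp θ), ?_, ?_⟩
    · have hc : Tendsto (fun ρ : ℝ => 1 - (ρ : ℂ) * unitExp θ) (𝓝[<] 1) (𝓝 (1 - unitExp θ)) := by
        have : Continuous fun ρ : ℝ => 1 - (ρ : ℂ) * unitExp θ := by fun_prop
        simpa using (this.tendsto 1).mono_left nhdsWithin_le_nhds
      refine ((hc.clog (Or.inl hre)).neg).congr' ?_
      filter_upwards [eventually_mem_Ico_zero_one] with ρ hρ
      rw [polylogSeries_one (by rw [norm_ofReal_mul_unitExp hρ.1]; exact hρ.2)]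
    · have h : -Complex.log (1 - unitExp θ) +
          (-1) ^ 1 * starRingEnd ℂ (-Complex.log (1 - unitExp θ))
          = -(2 * ((1 - unitExp θ).arg : ℂ) * Complex.I) := by
        apply Complex.ext
        · simp [Complex.log_re]
        · simp [Complex.log_im]
          ring
      rw [h, arg_one_sub_unitExp hθ, bernoulliFun_one]
      push_cast
      simp
      ring
  · refine ⟨polylogSeries n (unitExp θ), ?_,
      polylogSeries_unitExp_add_conj hn (Set.Ioo_subset_Icc_self hθ)⟩
    refine tendsto_tsum_of_dominated_convergence (summable_pnat_inv_pow hn) (fun x => ?_) ?_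
    · have : Continuous fun ρ : ℝ => ((ρ : ℂ) * unitExp θ) ^ (x : ℕ) / ((x : ℕ) : ℂ) ^ n := by
        fun_prop
      simpa using (this.tendsto 1).mono_left nhdsWithin_le_nhds
    · filter_upwards [eventually_mem_Ico_zero_one] with ρ hρ x
      exact norm_polylog_term_le_inv_pow n
        (by rw [norm_ofReal_mul_unitExp hρ.1]; exact hρ.2.le) x

theorem norm_one_sub_ofReal_mul_unitExp_bounds {ρ θ : ℝ} (h0 : 0 ≤ ρ) (h1 : ρ < 1)
    (hθ : θ ∈ Set.Ioo (0 : ℝ) 1) :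
    θ * (1 - θ) ≤ ‖1 - (ρ : ℂ) * unitExp θ‖ ∧ ‖1 - (ρ : ℂ) * unitExp θ‖ ≤ 2 := by
  have hn := norm_ofReal_mul_unitExp h0 θ
  constructor
  · have hA : ‖1 - unitExp θ‖ ≤ ‖1 - (ρ : ℂ) * unitExp θ‖ + (1 - ρ) := by
      have h2 : ‖((ρ - 1 : ℝ) : ℂ) * unitExp θ‖ = 1 - ρ := by
        rw [norm_mul, norm_unitExp, mul_one, Complex.norm_real, Real.norm_of_nonpos (by linarith)]
        ring
      rw [← h2]
      refine le_trans (le_of_eq ?_) (norm_add_le _ _)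
      congr 1
      push_cast
      ring
    have hB : 1 - ρ ≤ ‖1 - (ρ : ℂ) * unitExp θ‖ := by
      have := norm_sub_norm_le (1 : ℂ) ((ρ : ℂ) * unitExp θ)
      rwa [norm_one, hn] at this
    rw [norm_one_sub_unitExp hθ] at hA
    linarith [mul_one_sub_le_sin hθ]
  · have := norm_sub_le (1 : ℂ) ((ρ : ℂ) * unitExp θ)
    rw [norm_one, hn] at this
    linarith

/-- A bound for the polylogarithm, uniform in the radius, with an arbitrarily mild singularity. -/
theorem exists_norm_polylogSeries_le {n : ℕ} (hn : 1 ≤ n) {ε : ℝ} (hε : 0 < ε) :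
    ∃ C : ℝ, 0 ≤ C ∧ ∀ ρ : ℝ, 0 ≤ ρ → ρ < 1 → ∀ θ ∈ Set.Ioo (0 : ℝ) 1,
      ‖polylogSeries n (ρ * unitExp θ)‖ ≤ C * (θ * (1 - θ)) ^ (-ε) := by
  have ht {θ : ℝ} (hθ : θ ∈ Set.Ioo (0 : ℝ) 1) : 0 < θ * (1 - θ) ∧ θ * (1 - θ) ≤ 1 / 2 := by
    refine ⟨mul_pos hθ.1 (by linarith [hθ.2]), by nlinarith [sq_nonneg (2 * θ - 1)]⟩
  have hone {θ : ℝ} (hθ : θ ∈ Set.Ioo (0 : ℝ) 1) : 1 ≤ (θ * (1 - θ)) ^ (-ε) :=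
    Real.one_le_rpow_of_pos_of_le_one_of_nonpos (ht hθ).1 (by linarith [(ht hθ).2]) (by linarith)
  rcases hn.eq_or_lt with rfl | hn
  · refine ⟨1 / ε + Real.pi, by positivity, fun ρ h0 h1 θ hθ => ?_⟩
    obtain ⟨hlo, hhi⟩ := norm_one_sub_ofReal_mul_unitExp_bounds h0 h1 hθ
    obtain ⟨htp, hth⟩ := ht hθ
    set t := θ * (1 - θ) with htdef
    set w := 1 - (ρ : ℂ) * unitExp θ with hw
    rw [polylogSeries_one (by rw [norm_ofReal_mul_unitExp h0]; exact h1), norm_neg]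
    have h2 : ‖Complex.log w‖ ≤ |Real.log ‖w‖| + Real.pi := by
      refine (Complex.norm_le_abs_re_add_abs_im _).trans ?_
      rw [Complex.log_re, Complex.log_im]
      gcongr
      exact Complex.abs_arg_le_pi _
    have hlt : Real.log t⁻¹ ≤ t ^ (-ε) / ε := by
      refine (Real.log_le_rpow_div (by positivity) hε).trans_eq ?_
      rw [Real.inv_rpow htp.le, Real.rpow_neg htp.le]
    have h3 : |Real.log ‖w‖| ≤ Real.log t⁻¹ := by
      rw [abs_le]
      constructor
      · rw [Real.log_inv, neg_neg]
        exact Real.log_le_log htp hlo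
      · refine Real.log_le_log (htp.trans_le hlo) (hhi.trans ?_)
        rw [le_inv_comm₀ two_pos htp]
        linarith
    have h4 : Real.pi * 1 ≤ Real.pi * t ^ (-ε) := by
      gcongr
      exact hone hθ
    calc ‖Complex.log w‖ ≤ t ^ (-ε) / ε + Real.pi * t ^ (-ε) := by linarith
      _ = _ := by ring
  · refine ⟨∑' x : ℕ+, (((x : ℕ) : ℝ) ^ n)⁻¹, tsum_nonneg fun _ => by positivity,
      fun ρ h0 h1 θ hθ => ?_⟩
    refine (tsum_of_norm_bounded (summable_pnat_inv_pow hn).hasSum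
      (norm_polylog_term_le_inv_pow n ?_)).trans ?_
    · rw [norm_ofReal_mul_unitExp h0]
      exact h1.le
    · exact le_mul_of_one_le_right (tsum_nonneg fun _ => by positivity) (hone hθ)

theorem intervalIntegrable_mul_one_sub_rpow :
    IntervalIntegrable (fun θ : ℝ => (θ * (1 - θ)) ^ (-(1 / 2) : ℝ)) volume 0 1 := by
  have h := (Complex.betaIntegral_convergent (u := 1 / 2) (v := 1 / 2) (by norm_num)
    (by norm_num)).norm
  refine h.congr_ae ?_
  rw [Set.uIoc_of_le zero_le_one, ← Measure.restrict_congr_set Ioo_ae_eq_Ioc]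
  filter_upwards [ae_restrict_mem measurableSet_Ioo] with θ hθ
  have h1 : 0 < 1 - θ := by linarith [hθ.2]
  rw [norm_mul, ← Complex.ofReal_one, ← Complex.ofReal_sub,
    Complex.norm_cpow_eq_rpow_re_of_pos hθ.1, Complex.norm_cpow_eq_rpow_re_of_pos h1,
    Real.mul_rpow hθ.1.le h1.le]
  norm_num

/-- In moments of powers of the polylogarithm, the symmetrised polylogarithm may be replaced by its
radial limit, a multiple of a Bernoulli polynomial. -/
theorem tendsto_integral_symm_polylog_sub {n a b : ℕ} (hn : 1 ≤ n) (ha : a ≠ 0) :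
    Tendsto (fun ρ : ℝ => ∫ θ in (0 : ℝ)..1,
      ((polylogSeries n (ρ * unitExp θ) +
          (-1) ^ n * starRingEnd ℂ (polylogSeries n (ρ * unitExp θ))) ^ a -
        (-(2 * Real.pi * Complex.I) ^ n / n.factorial * bernoulliFun n θ) ^ a) *
        polylogSeries n (ρ * unitExp θ) ^ b) (𝓝[<] 1) (𝓝 0) := by
  have hab : (0 : ℝ) < (a + b : ℕ) := by
    have : 0 < a + b := by omega
    exact_mod_cast this
  obtain ⟨C, hC0, hC⟩ := exists_norm_polylogSeries_le hn (ε := 1 / (2 * (a + b : ℕ)))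
    (by positivity)
  set s : ℝ → ℝ := fun θ => (θ * (1 - θ)) ^ (-(1 / (2 * ((a + b : ℕ) : ℝ)))) with hs
  have hIoo : ∀ᵐ θ : ℝ, θ ∈ Set.uIoc (0 : ℝ) 1 → θ ∈ Set.Ioo (0 : ℝ) 1 := by
    filter_upwards [compl_mem_ae_iff.2 (measure_singleton (1 : ℝ))] with θ h1 hθ
    rw [Set.uIoc_of_le zero_le_one] at hθ
    exact ⟨hθ.1, lt_of_le_of_ne hθ.2 h1⟩
  have hs0 {θ : ℝ} (hθ : θ ∈ Set.Ioo (0 : ℝ) 1) : 0 ≤ s θ :=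
    Real.rpow_nonneg (mul_nonneg hθ.1.le (by linarith [hθ.2])) _
  have hspow {θ : ℝ} (hθ : θ ∈ Set.Ioo (0 : ℝ) 1) :
      s θ ^ (a + b) = (θ * (1 - θ)) ^ (-(1 / 2) : ℝ) := by
    rw [hs, ← Real.rpow_natCast, ← Real.rpow_mul (mul_nonneg hθ.1.le (by linarith [hθ.2]))]
    congr 1
    field_simp
  have hsymm {l : ℂ} {M : ℝ} (h : ‖l‖ ≤ M) : ‖l + (-1) ^ n * starRingEnd ℂ l‖ ≤ 2 * M := by
    refine (norm_add_le _ _).trans ?_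
    rw [norm_mul, norm_pow, norm_neg, norm_one, one_pow, one_mul, RCLike.norm_conj]
    linarith
  rw [← intervalIntegral.integral_zero (E := ℂ) (a := (0 : ℝ)) (b := 1) (μ := volume)]
  refine intervalIntegral.tendsto_integral_filter_of_dominated_convergence
    (l := 𝓝[<] (1 : ℝ)) (fun θ => 2 * 2 ^ a * C ^ (a + b) * (θ * (1 - θ)) ^ (-(1 / 2) : ℝ)) ?_ ?_
    (intervalIntegrable_mul_one_sub_rpow.const_mul _) ?_
  · filter_upwards [eventually_mem_Ico_zero_one] with ρ hρ
    have := continuous_polylog_circle n hρ.1 hρ.2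
    exact Continuous.aestronglyMeasurable (by fun_prop)
  · filter_upwards [eventually_mem_Ico_zero_one] with ρ hρ
    filter_upwards [hIoo] with θ hθ' hθ
    replace hθ := hθ' hθ
    obtain ⟨l, hl, hlB⟩ := exists_tendsto_polylogSeries hn hθ
    have hlC : ‖l‖ ≤ C * s θ := le_of_tendsto hl.norm <| by
      filter_upwards [eventually_mem_Ico_zero_one] with ρ hρ using hC ρ hρ.1 hρ.2 θ hθ
    have hLC := hC ρ hρ.1 hρ.2 θ hθ
    have hs0θ := hs0 hθ
    rw [← hlB, norm_mul, norm_pow, ← hspow hθ]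
    calc _ ≤ ((2 * (C * s θ)) ^ a + (2 * (C * s θ)) ^ a) * (C * s θ) ^ b := by
          gcongr
          refine (norm_sub_le _ _).trans ?_
          rw [norm_pow, norm_pow]
          gcongr
          · exact hsymm hLC
          · exact hsymm hlC
      _ = _ := by ring
  · filter_upwards [hIoo] with θ hθ' hθ
    obtain ⟨l, hl, hlB⟩ := exists_tendsto_polylogSeries hn (hθ' hθ)
    rw [← hlB]
    have hconj := ((Complex.continuous_conj.tendsto l).comp hl).const_mul ((-1 : ℂ) ^ n)
    simpa using (((hl.add hconj).pow a).sub_const ((l + (-1) ^ n * starRingEnd ℂ l) ^ a)).mul (hl.pow b)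

end RadialLimit

section Reduction

/-- A rational polynomial is a good moment (with respect to `n`, `b`, `K`, `D`) if its moment
against the `b`-th power of the polylogarithm has an Abel limit which, after scaling by `(2πi)^D`,
has reducible real part. -/
noncomputable def reducibleMoments (n b K D : ℕ) : Submodule ℚ (Polynomial ℚ) where
  carrier := {q | ∃ z : ℂ, Tendsto (fun ρ : ℝ => ∫ θ in (0 : ℝ)..1,
      ((Polynomial.aeval θ q : ℝ) : ℂ) * polylogSeries n (ρ * unitExp θ) ^ b) (𝓝[<] 1) (𝓝 z) ∧
    ((2 * Real.pi * Complex.I) ^ D * z).re ∈ reducibleSpan K}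
  zero_mem' := ⟨0, by simp, by simp⟩
  add_mem' := by
    rintro p q ⟨y, hy, hy'⟩ ⟨z, hz, hz'⟩
    refine ⟨y + z, (hy.add hz).congr' ?_, ?_⟩
    · filter_upwards [eventually_mem_Ico_zero_one] with ρ hρ
      have := continuous_polylog_circle n hρ.1 hρ.2
      have hp (r : Polynomial ℚ) : Continuous fun θ : ℝ => Polynomial.aeval θ r :=
        Polynomial.continuous_aeval r
      have hp1 := hp p
      have hp2 := hp q
      rw [← intervalIntegral.integral_add (Continuous.intervalIntegrable (by fun_prop) _ _)
        (Continuous.intervalIntegrable (by fun_prop) _ _)]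
      refine intervalIntegral.integral_congr fun θ _ => ?_
      simp only [map_add, Complex.ofReal_add]
      ring
    · rw [mul_add, Complex.add_re]
      exact add_mem hy' hz'
  smul_mem' := by
    rintro c q ⟨z, hz, hz'⟩
    refine ⟨(c : ℂ) * z, (hz.const_mul (c : ℂ)).congr fun ρ => ?_, ?_⟩
    · rw [← intervalIntegral.integral_const_mul]
      refine intervalIntegral.integral_congr fun θ _ => ?_
      simp only [map_smul, Rat.smul_def, Complex.ofReal_mul, Complex.ofReal_ratCast]
      ring
    · rw [mul_left_comm, ← Complex.ofReal_ratCast, Complex.re_ofReal_mul, ← Rat.smul_def]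
      exact Submodule.smul_mem _ _ hz'

theorem aeval_bernoulli (r : ℕ) (θ : ℝ) :
    Polynomial.aeval θ (Polynomial.bernoulli r) = bernoulliFun r θ := by
  rw [bernoulliFun, Polynomial.eval_map_algebraMap]

theorem pow_mul_div_neg_pow {x : ℂ} (hx : x ≠ 0) (y : ℂ) (r : ℕ) :
    x ^ r * (y / (-x) ^ r) = (-1) ^ r * y := by
  have h : ((-1 : ℂ) ^ r) * (-1) ^ r = 1 := by rw [← mul_pow]; simp
  rw [mul_div_assoc', div_eq_iff (pow_ne_zero _ (neg_ne_zero.2 hx)), neg_pow x r]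
  linear_combination -(x ^ r * y) * h

theorem bernoulli_mem_reducibleMoments {n b K D r : ℕ} (hn : 1 ≤ n) (hbK : b ≤ K) (hK : 1 ≤ K)
    (hD : 1 ≤ D) (hr : r ≤ D) : Polynomial.bernoulli r ∈ reducibleMoments n b K D := by
  simp only [reducibleMoments, Submodule.mem_mk, AddSubmonoid.mem_mk, AddSubsemigroup.mem_mk,
    Set.mem_ofPred_eq, aeval_bernoulli]
  rcases eq_or_ne b 0 with rfl | hb
  · refine ⟨((∫ θ in (0 : ℝ)..1, bernoulliFun r θ : ℝ) : ℂ), ?_, ?_⟩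
    · simp only [pow_zero, mul_one, intervalIntegral.integral_ofReal]
      exact tendsto_const_nhds
    · rw [integral_bernoulliFun]
      split_ifs
      · simpa using re_two_pi_I_pow_mem hK hD
      · simp
  · rcases r.eq_zero_or_pos with rfl | hr0
    · refine ⟨0, tendsto_const_nhds.congr' ?_, by simp⟩
      filter_upwards [eventually_mem_Ico_zero_one] with ρ hρ
      simp only [bernoulliFun_zero, Complex.ofReal_one, one_mul]
      exact (integral_polylog_pow hb hρ.1 hρ.2).symm
    · refine ⟨_, tendsto_integral_bernoulliFun_mul_polylog_pow hn hr0 hb, ?_⟩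
      have hpi : (2 * Real.pi * Complex.I : ℂ) ≠ 0 := Complex.two_pi_I_ne_zero
      set M := MTZ (Fin.snoc (α := fun _ => ℕ) (fun _ : Fin b => n) r) with hM
      have h : (2 * Real.pi * Complex.I) ^ D *
          (-(r.factorial : ℂ) / (-(2 * Real.pi * Complex.I)) ^ r * (M : ℂ))
          = ((-(-1) ^ r * r.factorial : ℚ) : ℝ) *
            ((2 * Real.pi * Complex.I) ^ (D - r) * (M : ℂ)) := by
        have h1 := pow_mul_div_neg_pow hpi (-(r.factorial : ℂ)) r
        rw [← Nat.sub_add_cancel hr, pow_add, Nat.sub_add_cancel hr]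
        push_cast
        linear_combination (2 * Real.pi * Complex.I) ^ (D - r) * (M : ℂ) * h1
      rw [h, Complex.re_ofReal_mul, ← Rat.smul_def]
      refine Submodule.smul_mem _ _
        (re_two_pi_I_pow_mul_MTZ_mem (Nat.one_le_iff_ne_zero.2 hb) hbK _ fun i => ?_)
      refine Fin.lastCases ?_ (fun j => ?_) i
      · simpa using Nat.succ_le_of_lt hr0
      · simpa using hn

theorem mem_reducibleMoments {n b K D : ℕ} (hn : 1 ≤ n) (hbK : b ≤ K) (hK : 1 ≤ K)
    (hD : 1 ≤ D) {q : Polynomial ℚ} (hq : q.natDegree ≤ D) : q ∈ reducibleMoments n b K D := by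
  rw [q.as_sum_range]
  refine sum_mem fun j hj => ?_
  have hj' : j ≤ D := (Nat.lt_succ_iff.1 (Finset.mem_range.1 hj)).trans hq
  have h : Polynomial.monomial j (q.coeff j) = (q.coeff j / (j + 1 : ℚ)) •
      ∑ r ∈ Finset.range (j + 1), ((j + 1).choose r : ℚ) • Polynomial.bernoulli r := by
    have hj0 : (j + 1 : ℚ) ≠ 0 := by positivity
    rw [Polynomial.sum_bernoulli, Polynomial.smul_monomial, smul_eq_mul, div_mul_cancel₀ _ hj0]
  rw [h]
  exact Submodule.smul_mem _ _ (sum_mem fun r hr => Submodule.smul_mem _ _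
    (bernoulli_mem_reducibleMoments hn hbK hK hD
      ((Nat.lt_succ_iff.1 (Finset.mem_range.1 hr)).trans hj')))

theorem natDegree_bernoulli_le (n : ℕ) : (Polynomial.bernoulli n).natDegree ≤ n := by
  rw [Polynomial.bernoulli_def]
  exact Polynomial.natDegree_sum_le_of_forall_le _ _ fun i hi =>
    (Polynomial.natDegree_monomial_le _).trans (Nat.lt_succ_iff.1 (Finset.mem_range.1 hi))

theorem tendsto_integral_symm_polylog {n a b : ℕ} (hn : 1 ≤ n) (ha : a ≠ 0) {z : ℂ}
    (hz : Tendsto (fun ρ : ℝ => ∫ θ in (0 : ℝ)..1,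
      ((bernoulliFun n θ : ℝ) : ℂ) ^ a * polylogSeries n (ρ * unitExp θ) ^ b) (𝓝[<] 1) (𝓝 z)) :
    Tendsto (fun ρ : ℝ => ∫ θ in (0 : ℝ)..1,
      (polylogSeries n (ρ * unitExp θ) +
          (-1) ^ n * starRingEnd ℂ (polylogSeries n (ρ * unitExp θ))) ^ a *
        polylogSeries n (ρ * unitExp θ) ^ b) (𝓝[<] 1)
      (𝓝 ((-(2 * Real.pi * Complex.I) ^ n / n.factorial) ^ a * z)) := by
  have h := (tendsto_integral_symm_polylog_sub (b := b) hn ha).add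
    (hz.const_mul ((-(2 * Real.pi * Complex.I) ^ n / n.factorial) ^ a))
  rw [zero_add] at h
  refine h.congr' ?_
  filter_upwards [eventually_mem_Ico_zero_one] with ρ hρ
  have := continuous_polylog_circle n hρ.1 hρ.2
  rw [← intervalIntegral.integral_const_mul, ← intervalIntegral.integral_add
    (Continuous.intervalIntegrable (by fun_prop) _ _)
    (Continuous.intervalIntegrable (by fun_prop) _ _)]
  refine intervalIntegral.integral_congr fun θ _ => ?_
  simp only [mul_pow]
  ring

theorem sum_choose_mul_integral_symm_polylog (n k : ℕ) {ρ : ℝ} (h0 : 0 ≤ ρ) (h1 : ρ < 1) :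
    ∑ a ∈ Finset.range (k + 2), ((-1 : ℂ) ^ (k + 1 - a) * (k + 1).choose a) *
      ∫ θ in (0 : ℝ)..1, (polylogSeries n (ρ * unitExp θ) +
          (-1) ^ n * starRingEnd ℂ (polylogSeries n (ρ * unitExp θ))) ^ a *
        polylogSeries n (ρ * unitExp θ) ^ (k + 1 - a) = 0 := by
  have := continuous_polylog_circle n h0 h1
  simp only [← intervalIntegral.integral_const_mul]
  rw [← intervalIntegral.integral_finsetSum
    fun a _ => Continuous.intervalIntegrable (by fun_prop) _ _]
  have hconj : ∫ θ in (0 : ℝ)..1, starRingEnd ℂ (polylogSeries n (ρ * unitExp θ) ^ (k + 1)) = 0 := by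
    have h := integral_polylog_pow (n := n) (b := k + 1) (by omega) h0 h1
    rw [intervalIntegral.integral_of_le zero_le_one] at h ⊢
    rw [integral_conj, h, map_zero]
  rw [← mul_zero (((-1 : ℂ) ^ n) ^ (k + 1)), ← hconj, ← intervalIntegral.integral_const_mul]
  refine intervalIntegral.integral_congr fun θ _ => ?_
  simp only [map_pow]
  generalize polylogSeries n (ρ * unitExp θ) = l
  have h : (-1) ^ n * starRingEnd ℂ l = (l + (-1) ^ n * starRingEnd ℂ l) + (-l) := by ring
  rw [← mul_pow, h, add_pow, ← h]
  refine Finset.sum_congr rfl fun a _ => ?_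
  rw [neg_pow l]
  ring

theorem exists_tendsto_integral_symm_polylog {n k a : ℕ} (hn : 1 ≤ n) (hk : 2 ≤ k) (ha : 2 ≤ a) :
    ∃ w : ℂ, Tendsto (fun ρ : ℝ => ∫ θ in (0 : ℝ)..1,
      (polylogSeries n (ρ * unitExp θ) +
          (-1) ^ n * starRingEnd ℂ (polylogSeries n (ρ * unitExp θ))) ^ a *
        polylogSeries n (ρ * unitExp θ) ^ (k + 1 - a)) (𝓝[<] 1) (𝓝 w) ∧
      w.re ∈ reducibleSpan (k - 1) := by
  obtain ⟨z, hz, hz'⟩ := mem_reducibleMoments (b := k + 1 - a) (K := k - 1) (D := a * n)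
    (q := Polynomial.bernoulli n ^ a) hn (by omega) (by omega) (by nlinarith)
    (Polynomial.natDegree_pow_le_of_le a (natDegree_bernoulli_le n))
  simp only [map_pow, aeval_bernoulli, Complex.ofReal_pow] at hz
  refine ⟨_, tendsto_integral_symm_polylog hn (by omega) hz, ?_⟩
  have h : (-(2 * Real.pi * Complex.I) ^ n / n.factorial) ^ a * z
      = (((-1 / n.factorial) ^ a : ℚ) : ℝ) * ((2 * Real.pi * Complex.I) ^ (a * n) * z) := by
    push_cast
    rw [mul_comm a n, pow_mul, ← mul_assoc, ← mul_pow]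
    congr 2
    ring
  rw [h, Complex.re_ofReal_mul, ← Rat.smul_def]
  exact Submodule.smul_mem _ _ hz'

theorem MTZ_const_mem_reducibleSpan {n k : ℕ} (hn : 1 ≤ n) (hk : 2 ≤ k) :
    MTZ (fun _ : Fin (k + 1) => n) ∈ reducibleSpan (k - 1) := by
  set M := MTZ (fun _ : Fin (k + 1) => n) with hM
  have h1 := tendsto_integral_symm_polylog (a := 1) (b := k) hn one_ne_zero
    (by simpa only [pow_one] using
      tendsto_integral_bernoulliFun_mul_polylog_pow hn hn (b := k) (by omega))
  rw [show Fin.snoc (α := fun _ => ℕ) (fun _ : Fin k => n) n = fun _ : Fin (k + 1) => n by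
      ext i; refine Fin.lastCases ?_ (fun j => ?_) i <;> simp, ← hM,
    show (-(2 * Real.pi * Complex.I) ^ n / n.factorial) ^ 1 *
      (-(n.factorial : ℂ) / (-(2 * Real.pi * Complex.I)) ^ n * (M : ℂ)) = (-1) ^ n * (M : ℂ) by
        have h := pow_mul_div_neg_pow Complex.two_pi_I_ne_zero (-(n.factorial : ℂ)) n
        have hf : (n.factorial : ℂ) ≠ 0 := by exact_mod_cast n.factorial_ne_zero
        rw [pow_one, div_mul_eq_mul_div, div_eq_iff hf]
        linear_combination -(M : ℂ) * h] at h1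
  choose W hW hWre using fun a : ℕ => exists_tendsto_integral_symm_polylog (a := a + 2) hn hk
    (by omega)
  have hlim := (tendsto_finsetSum (Finset.range k) fun a _ => (hW a).const_mul
    ((-1 : ℂ) ^ (k + 1 - (a + 2)) * (k + 1).choose (a + 2))).add
      (h1.const_mul ((-1 : ℂ) ^ k * (k + 1 : ℕ)))
  have hzero := tendsto_nhds_unique (hlim.congr' (f₂ := fun _ => 0) ?_) tendsto_const_nhds
  · set c : ℕ → ℚ := fun a => (-1) ^ (k + 1 - (a + 2)) * (k + 1).choose (a + 2)
    have hre : ∑ a ∈ Finset.range k, c a • (W a).re + ((-1) ^ k * (k + 1) * (-1) ^ n : ℚ) • M = 0 := by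
      have := congrArg Complex.re hzero
      rw [Complex.add_re, Complex.re_sum, Complex.zero_re] at this
      rw [← this]
      congr 1
      · refine Finset.sum_congr rfl fun a _ => ?_
        rw [Rat.smul_def, ← Complex.re_ofReal_mul]
        simp [c]
      · rw [Rat.smul_def, ← Complex.ofReal_re ((_ : ℝ) * M)]
        congr 1
        push_cast
        ring
    have hc : ((-1) ^ k * (k + 1) * (-1) ^ n : ℚ) ≠ 0 := by
      have : (k + 1 : ℚ) ≠ 0 := by positivity
      simp [this]
    rw [← Submodule.smul_mem_iff _ hc, eq_neg_of_add_eq_zero_right hre]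
    exact neg_mem (sum_mem fun a _ => Submodule.smul_mem _ _ (hWre a))
  · filter_upwards [eventually_mem_Ico_zero_one] with ρ hρ
    have h := sum_choose_mul_integral_symm_polylog n k hρ.1 hρ.2
    rw [Finset.sum_range_succ', Finset.sum_range_succ'] at h
    simp only [pow_zero, one_mul, Nat.sub_zero, integral_polylog_pow (Nat.succ_ne_zero k) hρ.1 hρ.2,
      mul_zero, add_zero] at h
    simpa using h

end Reduction

theorem stmt1 (n k : ℕ) (hn : 1 ≤ n) (hk : 2 ≤ k) :
    ∃ (M : ℕ) (c : Fin M → ℚ) (T : Fin M → List ((d : ℕ) × (Fin (d + 1) → ℕ))),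
      (∀ m : Fin M, T m ≠ [] ∧
        ∀ p ∈ T m, 1 ≤ p.1 ∧ p.1 ≤ k - 1 ∧ (∀ i, 1 ≤ p.2 i)) ∧
      MTZ (fun _ : Fin (k + 1) => n)
        = ∑ m : Fin M, (c m : ℝ) * ((T m).map fun p => MTZ p.2).prod :=
  exists_sum_of_mem_reducibleSpan (MTZ_const_mem_reducibleSpan hn hk)
end

section
/- Let a, b be positive integers, χ a primitive Dirichlet character, and z ∈ ℂ with Re(z) ≥ 1. Then L_MT(a,b,z; 1,1,χ) + (−1)^b L_MT(z,b,a; χ,1,1) + (−1)^a L_MT(a,z,b; 1,χ,1) = 2 Σ_{r=0}^{⌊max(a,b)/2⌋} [ C(a+b−2r−1, a−1) + C(a+b−2r−1, a−2r) ] ζ(2r) L(a+b+z−2r; χ), where C(n,m) denotes the binomial coefficient (equal to 0 if m < 0 or m > n) and L(s;χ) = Σ_{m≥1} χ(m)/m^s. -/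
open Complex

/-- Binomial coefficient `C(n,m)` for integer arguments, `0` if `m < 0` or `m > n`. -/
def zbinom (n m : ℤ) : ℕ := if 0 ≤ m ∧ m ≤ n then n.toNat.choose m.toNat else 0

/-- The Mordell–Tornheim `L`-value with exponents `(s₁,…,s_k,t)` and coloring
functions `χs`. -/
noncomputable def LMT {k : ℕ} (s : Fin k → ℂ) (t : ℂ) (χs : Fin (k + 1) → ℕ → ℂ) : ℂ :=
  ∑' m : Fin k → ℕ+,
    (∏ j : Fin k, χs j.castSucc (m j : ℕ) * (((m j : ℕ) : ℂ) ^ s j)⁻¹) *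
      (χs (Fin.last k) (∑ j : Fin k, (m j : ℕ)) *
        ((∑ j : Fin k, ((m j : ℕ) : ℂ)) ^ t)⁻¹)

/-- The Dirichlet series `L(t;w) = Σ_{m≥1} w(m)/m^t`. -/
noncomputable def Lgen (w : ℕ → ℂ) (t : ℂ) : ℂ :=
  ∑' m : ℕ+, w (m : ℕ) * (((m : ℕ) : ℂ) ^ t)⁻¹

open Finset in
/-- The contribution of one axis of boundary values to the solution of the recurrence
`f (a+1) (b+1) = y * (f a (b+1) + f (a+1) b)`. -/
def axisSum (y : ℂ) (g : ℕ → ℂ) (a b : ℕ) : ℂ :=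
  ∑ k ∈ range (a + 1), ((b + k).choose b : ℂ) * y ^ (b + 1 + k) * g (a - k)

lemma axisSum_succ_succ (y : ℂ) (g : ℕ → ℂ) (a b : ℕ) :
    axisSum y g (a + 1) (b + 1) = y * (axisSum y g a (b + 1) + axisSum y g (a + 1) b) := by
  simp only [axisSum]
  rw [Finset.sum_range_succ' _ (a + 1), Finset.sum_range_succ' _ (a + 1), ← add_assoc,
    ← Finset.sum_add_distrib, mul_add, Finset.mul_sum]
  congr 1
  · refine Finset.sum_congr rfl fun k _ => ?_
    have h : ((b + 1 + (k + 1)).choose (b + 1) : ℂ)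
        = (b + (k + 1)).choose b + (b + 1 + k).choose (b + 1) := by
      rw [show b + 1 + (k + 1) = (b + (k + 1)) + 1 by ring, Nat.choose_succ_succ,
        show b + 1 + k = b + (k + 1) by ring]
      push_cast
      rfl
    rw [h, Nat.add_sub_add_right]
    ring
  · simp
    ring

lemma axisSum_succ_zero (y : ℂ) (g : ℕ → ℂ) (a : ℕ) :
    axisSum y g (a + 1) 0 = y * (axisSum y g a 0 + g (a + 1)) := by
  simp only [axisSum]
  rw [Finset.sum_range_succ' _ (a + 1), mul_add, Finset.mul_sum]
  congr 1
  · refine Finset.sum_congr rfl fun k _ => ?_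
    simp
    ring
  · simp

lemma axisSum_zero_left (y : ℂ) (g : ℕ → ℂ) (b : ℕ) : axisSum y g 0 b = y ^ (b + 1) * g 0 := by
  simp [axisSum]

lemma eq_axisSum_add_axisSum (y : ℂ) (f : ℕ → ℕ → ℂ)
    (h : ∀ a b, f (a + 1) (b + 1) = y * (f a (b + 1) + f (a + 1) b)) (a b : ℕ) :
    f (a + 1) (b + 1)
      = axisSum y (fun i => f (i + 1) 0) a b + axisSum y (fun j => f 0 (j + 1)) b a := by
  induction a generalizing b with
  | zero =>
    induction b with
    | zero => rw [h, axisSum_zero_left, axisSum_zero_left]; ring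
    | succ b ih =>
      rw [h, ih, axisSum_succ_zero, axisSum_zero_left, axisSum_zero_left]; ring
  | succ a iha =>
    induction b with
    | zero => rw [h, iha, axisSum_succ_zero, axisSum_zero_left, axisSum_zero_left]; ring
    | succ b ihb => rw [h, iha, ihb, axisSum_succ_succ, axisSum_succ_succ]; ring

/-- The sum of the `k`-th terms of `m ↦ 1 / (m ^ a * (N - m) ^ b)` over `0 < m < N`, `N < m`
and `m < 0`. -/
noncomputable def slice (N : ℕ+) (k : ℕ+) (a b : ℕ) : ℂ :=
  (if k < N then (((k : ℕ) : ℂ) ^ a)⁻¹ * ((((N : ℕ) : ℂ) - (k : ℕ)) ^ b)⁻¹ else 0)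
    + (-1) ^ b * ((((k : ℕ) : ℂ) ^ b)⁻¹ * ((((k : ℕ) : ℂ) + (N : ℕ)) ^ a)⁻¹)
    + (-1) ^ a * ((((k : ℕ) : ℂ) ^ a)⁻¹ * ((((k : ℕ) : ℂ) + (N : ℕ)) ^ b)⁻¹)

lemma slice_succ_succ (N k : ℕ+) (a b : ℕ) :
    slice N k (a + 1) (b + 1)
      = ((N : ℕ) : ℂ)⁻¹ * (slice N k a (b + 1) + slice N k (a + 1) b) := by
  have hN : ((N : ℕ) : ℂ) ≠ 0 := by simp
  have hk : ((k : ℕ) : ℂ) ≠ 0 := by simp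
  have hkN : ((k : ℕ) : ℂ) + (N : ℕ) ≠ 0 := by
    exact_mod_cast (k + N).ne_zero
  unfold slice
  split_ifs with h
  · have hs : ((N : ℕ) : ℂ) - (k : ℕ) ≠ 0 := by
      rw [sub_ne_zero]
      exact_mod_cast h.ne'
    simp only [pow_succ]
    field_simp
    ring
  · simp only [pow_succ]
    field_simp
    ring

lemma hasSum_inv_pow_telescope (M a : ℕ) (ha : 1 ≤ a) :
    HasSum (fun k : ℕ+ => ((((k : ℕ) : ℂ) + M) ^ a)⁻¹ - ((((k : ℕ) : ℂ) + M + 1) ^ a)⁻¹)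
      (((M : ℂ) + 1) ^ a)⁻¹ := by
  let f : ℕ → ℝ := fun n => (((n : ℝ) + 1 + M) ^ a)⁻¹
  have hanti : ∀ n, f (n + 1) ≤ f n := fun n => by
    simp only [f]
    gcongr
    simp
  have hlim : Filter.Tendsto f Filter.atTop (nhds 0) := by
    refine Filter.Tendsto.inv_tendsto_atTop ?_
    refine (Filter.tendsto_pow_atTop (by omega)).comp ?_
    refine Filter.tendsto_atTop_add_const_right _ _ ?_
    exact Filter.tendsto_atTop_add_const_right _ _ tendsto_natCast_atTop_atTop
  have h : HasSum (fun n => f n - f (n + 1)) (f 0) := by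
    rw [hasSum_iff_tendsto_nat_of_nonneg fun n => sub_nonneg.2 (hanti n)]
    simp_rw [Finset.sum_range_sub']
    simpa using hlim.const_sub (f 0)
  have h2 := Complex.hasSum_ofReal.2 h
  rw [← Equiv.pnatEquivNat.hasSum_iff] at h2
  convert h2 using 1
  · funext k
    have hk : (((k.natPred : ℕ) : ℂ)) + 1 = (k : ℕ) := by
      exact_mod_cast k.natPred_add_one
    simp only [Function.comp, Equiv.pnatEquivNat_apply, f]
    push_cast
    rw [hk]
    congr 3
    ring
  · simp only [f]
    push_cast
    congr 2
    ring

lemma hasSum_of_eq {ι : Type*} {f g : ι → ℂ} {s t : ℂ} (h : HasSum f s)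
    (hf : ∀ i, g i = f i) (hs : t = s) : HasSum g t := by
  rwa [funext hf, hs]

lemma hasSum_axis_remainder (N : ℕ+) (a : ℕ) (ha : 1 ≤ a) :
    HasSum (fun k : ℕ+ => (if k < N then (((k : ℕ) : ℂ) ^ a)⁻¹ else 0)
      + ((((k : ℕ) : ℂ) + (N : ℕ)) ^ a)⁻¹ - (((k : ℕ) : ℂ) ^ a)⁻¹)
      (-(((N : ℕ) : ℂ) ^ a)⁻¹) := by
  induction N using PNat.recOn with
  | one =>
    have h := (hasSum_inv_pow_telescope 0 a ha).neg
    refine hasSum_of_eq h (fun k => ?_) ?_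
    · simp
    · simp
  | succ N ih =>
    have h := (ih.sub (hasSum_inv_pow_telescope N a ha)).add
      (hasSum_ite_eq N ((((N : ℕ) : ℂ) ^ a)⁻¹))
    refine hasSum_of_eq h (fun k => ?_) ?_
    · rcases lt_trichotomy k N with hk | rfl | hk
      · rw [if_pos hk, if_pos (hk.trans (PNat.lt_add_right _ _)), if_neg hk.ne]
        push_cast
        ring
      · simp [add_assoc]
      · rw [if_neg hk.not_gt, if_neg (not_lt.2 (PNat.add_one_le_iff.2 hk)), if_neg hk.ne']
        push_cast
        ring
    · push_cast
      ring

lemma hasSum_even_zeta (a : ℕ) (ha : 1 ≤ a) :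
    HasSum (fun k : ℕ+ => (1 + (-1) ^ a) * (((k : ℕ) : ℂ) ^ a)⁻¹)
      ((1 + (-1) ^ a) * riemannZeta a) := by
  rcases Nat.even_or_odd a with h | h
  · have h1 : 1 < a := by
      rcases h with ⟨c, rfl⟩
      omega
    refine HasSum.mul_left _ ?_
    rw [zeta_nat_eq_tsum_of_gt_one h1]
    have hs : Summable (fun n : ℕ => 1 / (n : ℂ) ^ a) := by
      simpa using Complex.summable_one_div_nat_cpow (p := a) |>.2 (by simpa using h1)
    have hinj : Function.Injective (fun k : ℕ+ => (k : ℕ)) := PNat.coe_injective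
    have := (hinj.hasSum_iff (f := fun n : ℕ => 1 / (n : ℂ) ^ a) (fun n hn => by
      have : n = 0 := by
        by_contra h0
        exact hn ⟨⟨n, Nat.pos_of_ne_zero h0⟩, rfl⟩
      subst this
      simp [show a ≠ 0 by omega])).2 hs.hasSum
    simpa [Function.comp_def] using this
  · simp [h.neg_one_pow]

lemma hasSum_slice_right_zero (N : ℕ+) (a : ℕ) (ha : 1 ≤ a) :
    HasSum (fun k => slice N k a 0)
      ((1 + (-1) ^ a) * riemannZeta a - (((N : ℕ) : ℂ)⁻¹) ^ a) := by
  convert (hasSum_even_zeta a ha).add (hasSum_axis_remainder N a ha) using 1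
  · funext k
    simp [slice]
    ring
  · rw [inv_pow]
    ring

lemma hasSum_reflect (N : ℕ+) (g : ℂ → ℂ) :
    HasSum (fun k : ℕ+ => (if k < N then g (((N : ℕ) : ℂ) - (k : ℕ)) else 0)
      - (if k < N then g ((k : ℕ) : ℂ) else 0)) 0 := by
  have h1 := hasSum_sum_of_ne_finset_zero
    (L := SummationFilter.unconditional _) (s := Finset.Iio N)
    (f := fun k : ℕ+ => (if k < N then g (((N : ℕ) : ℂ) - (k : ℕ)) else 0)
      - (if k < N then g ((k : ℕ) : ℂ) else 0)) (fun k hk => by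
        simp only [Finset.mem_Iio] at hk
        simp [hk])
  convert h1 using 1
  rw [Finset.sum_sub_distrib, eq_comm, sub_eq_zero]
  have hcoe : ∀ k : ℕ+, k < N → ((N - k : ℕ+) : ℕ) = N - k := fun k hk => by
    rw [PNat.sub_coe, if_pos hk]
  have hlt : ∀ k : ℕ+, k < N → N - k < N := fun k hk => by
    rw [← PNat.coe_lt_coe, hcoe k hk]
    have := k.pos
    have := N.pos
    omega
  have hinv : ∀ k : ℕ+, k < N → N - (N - k) = k := fun k hk => by
    rw [← PNat.coe_inj, hcoe _ (hlt k hk), hcoe k hk]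
    have := PNat.coe_lt_coe _ _ |>.2 hk
    omega
  refine Finset.sum_nbij' (fun k => N - k) (fun k => N - k) ?_ ?_ ?_ ?_ ?_
  all_goals
    intro k hk
    simp only [Finset.mem_Iio] at hk ⊢
  · exact hlt k hk
  · exact hlt k hk
  · exact hinv k hk
  · exact hinv k hk
  · have h3 : (k : ℕ) ≤ N := (PNat.coe_lt_coe _ _ |>.2 hk).le
    rw [if_pos hk, if_pos (hlt k hk), hcoe k hk, Nat.cast_sub h3]

lemma hasSum_slice_zero_left (N : ℕ+) (b : ℕ) (hb : 1 ≤ b) :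
    HasSum (fun k => slice N k 0 b)
      ((1 + (-1) ^ b) * riemannZeta b - (((N : ℕ) : ℂ)⁻¹) ^ b) := by
  convert (hasSum_slice_right_zero N b hb).add (hasSum_reflect N fun x => (x ^ b)⁻¹) using 1
  · funext k
    simp [slice]
    ring
  · simp

lemma hasSum_axisSum {ι : Type*} (y : ℂ) (u : ι → ℕ → ℂ) (g : ℕ → ℂ)
    (h : ∀ i, HasSum (fun k => u k i) (g i)) (a b : ℕ) :
    HasSum (fun k => axisSum y (u k) a b) (axisSum y g a b) :=
  hasSum_sum fun i _ => (h (a - i)).mul_left _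

lemma sum_range_one_add_neg_one_pow (h : ℕ → ℂ) (n : ℕ) :
    ∑ i ∈ Finset.range (n + 1), (1 + (-1) ^ i) * h i
      = 2 * ∑ r ∈ Finset.range (n / 2 + 1), h (2 * r) := by
  induction n with
  | zero => norm_num
  | succ n ih =>
    rw [Finset.sum_range_succ, ih]
    rcases Nat.even_or_odd' n with ⟨c, rfl | rfl⟩
    · rw [show (2 * c + 1) / 2 = 2 * c / 2 by omega]
      simp [pow_succ]
    · rw [show (2 * c + 1 + 1) / 2 = (2 * c + 1) / 2 + 1 by omega,
        Finset.sum_range_succ _ ((2 * c + 1) / 2 + 1),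
        show (2 * c + 1) / 2 + 1 = c + 1 by omega]
      simp [pow_succ, pow_mul]
      ring_nf

/-- `axisSum` of the boundary values `(1 + (-1)^i) ζ(i) - y^i`. -/
lemma axisSum_zeta (y : ℂ) (a b : ℕ) :
    axisSum y (fun i => (1 + (-1) ^ (i + 1)) * riemannZeta ((i + 1 : ℕ) : ℂ) - y ^ (i + 1)) a b
      = 2 * ∑ r ∈ Finset.range ((a + 1) / 2 + 1), ((a + b + 1 - 2 * r).choose b : ℂ)
          * riemannZeta ((2 * r : ℕ) : ℂ) * y ^ (a + b + 2 - 2 * r)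
        + ((a + b + 1).choose b : ℂ) * y ^ (a + b + 2)
        - ((a + b + 1).choose (b + 1) : ℂ) * y ^ (a + b + 2) := by
  rw [← sum_range_one_add_neg_one_pow (fun i => ((a + b + 1 - i).choose b : ℂ)
          * riemannZeta (i : ℂ) * y ^ (a + b + 2 - i)) (a + 1),
    Finset.sum_range_succ' _ (a + 1), ← Finset.sum_range_reflect _ (a + 1)]
  have h := Nat.sum_range_add_choose a b
  rw [← h]
  simp only [axisSum, mul_sub, Finset.sum_sub_distrib]
  push_cast
  rw [Finset.sum_mul]
  have e1 : ∀ k ∈ Finset.range (a + 1), ((b + k).choose b : ℂ) * y ^ (b + 1 + k) * y ^ (a - k + 1)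
      = ((k + b).choose b : ℂ) * y ^ (a + b + 2) := fun k hk => by
    have : k ≤ a := by simpa [Nat.lt_succ_iff] using hk
    rw [mul_assoc, ← pow_add, add_comm b k, show b + 1 + k + (a - k + 1) = a + b + 2 by omega]
  rw [Finset.sum_congr rfl e1]
  congr 1
  simp only [riemannZeta_zero, pow_zero]
  rw [add_assoc, show ∀ c d : ℂ, (1 + 1) * (c * (-1 / 2) * d) + c * d = 0 by intros; ring,
    add_zero]
  refine Finset.sum_congr rfl fun k hk => ?_
  have : k ≤ a := by simpa [Nat.lt_succ_iff] using hk
  rw [show a + b - (a - k) = b + k by omega, show a + b + 1 - (a - k) = b + 1 + k by omega]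
  ring

lemma zbinom_natCast (n m : ℕ) : zbinom n m = n.choose m := by
  unfold zbinom
  split_ifs with h
  · simp
  · rw [Nat.choose_eq_zero_of_lt]
    omega

lemma zbinom_of_neg {n m : ℤ} (h : m < 0) : zbinom n m = 0 := by
  unfold zbinom
  rw [if_neg]
  omega

lemma zbinom_of_lt {n m : ℤ} (h : n < m) : zbinom n m = 0 := by
  unfold zbinom
  rw [if_neg]
  omega

lemma hasSum_slice (N : ℕ+) (a b : ℕ) (ha : 1 ≤ a) (hb : 1 ≤ b) :
    HasSum (fun k => slice N k a b)
      (2 * ∑ r ∈ Finset.range (max a b / 2 + 1),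
        ((zbinom ((a : ℤ) + b - 2 * r - 1) ((a : ℤ) - 1) : ℂ) +
            (zbinom ((a : ℤ) + b - 2 * r - 1) ((a : ℤ) - 2 * r) : ℂ)) *
          riemannZeta ((2 * r : ℕ) : ℂ) * ((N : ℕ) : ℂ)⁻¹ ^ (a + b - 2 * r)) := by
  obtain ⟨a, rfl⟩ := Nat.exists_eq_add_of_le' ha
  obtain ⟨b, rfl⟩ := Nat.exists_eq_add_of_le' hb
  set y := ((N : ℕ) : ℂ)⁻¹ with hy
  have h1 := hasSum_axisSum y (fun k i => slice N k (i + 1) 0) _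
    (fun i => hasSum_slice_right_zero N (i + 1) (by omega)) a b
  have h2 := hasSum_axisSum y (fun k i => slice N k 0 (i + 1)) _
    (fun i => hasSum_slice_zero_left N (i + 1) (by omega)) b a
  convert h1.add h2 using 1
  · funext k
    exact eq_axisSum_add_axisSum y (slice N k) (slice_succ_succ N k) a b
  rw [axisSum_zeta, axisSum_zeta]
  have e1 : ∑ r ∈ Finset.range ((a + 1) / 2 + 1), ((a + b + 1 - 2 * r).choose b : ℂ)
          * riemannZeta ((2 * r : ℕ) : ℂ) * y ^ (a + b + 2 - 2 * r)
      = ∑ r ∈ Finset.range (max (a + 1) (b + 1) / 2 + 1),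
        (zbinom (((a + 1 : ℕ) : ℤ) + (b + 1 : ℕ) - 2 * r - 1) (((a + 1 : ℕ) : ℤ) - 2 * r) : ℂ)
          * riemannZeta ((2 * r : ℕ) : ℂ) * y ^ (a + 1 + (b + 1) - 2 * r) := by
    rw [← Finset.sum_subset (Finset.range_mono (show (a + 1) / 2 + 1 ≤
      max (a + 1) (b + 1) / 2 + 1 by omega))]
    · refine Finset.sum_congr rfl fun r hr => ?_
      have hr' : 2 * r ≤ a + 1 := by
        have := Finset.mem_range.1 hr
        omega
      rw [show ((a + 1 : ℕ) : ℤ) + (b + 1 : ℕ) - 2 * r - 1 = ((a + b + 1 - 2 * r : ℕ) : ℤ) by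
          omega, show ((a + 1 : ℕ) : ℤ) - 2 * r = ((a + 1 - 2 * r : ℕ) : ℤ) by omega,
        zbinom_natCast, Nat.choose_symm_of_eq_add
          (show a + b + 1 - 2 * r = b + (a + 1 - 2 * r) by omega),
        show a + 1 + (b + 1) = a + b + 2 by ring]
    · intro r _ hr
      have hr' : a + 1 < 2 * r := by
        have := mt Finset.mem_range.2 hr
        omega
      rw [zbinom_of_neg (by omega)]
      simp
  have e2 : ∑ r ∈ Finset.range ((b + 1) / 2 + 1), ((b + a + 1 - 2 * r).choose a : ℂ)
          * riemannZeta ((2 * r : ℕ) : ℂ) * y ^ (b + a + 2 - 2 * r)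
      = ∑ r ∈ Finset.range (max (a + 1) (b + 1) / 2 + 1),
        (zbinom (((a + 1 : ℕ) : ℤ) + (b + 1 : ℕ) - 2 * r - 1) (((a + 1 : ℕ) : ℤ) - 1) : ℂ)
          * riemannZeta ((2 * r : ℕ) : ℂ) * y ^ (a + 1 + (b + 1) - 2 * r) := by
    rw [← Finset.sum_subset (Finset.range_mono (show (b + 1) / 2 + 1 ≤
      max (a + 1) (b + 1) / 2 + 1 by omega))]
    · refine Finset.sum_congr rfl fun r hr => ?_
      have hr' : 2 * r ≤ b + 1 := by
        have := Finset.mem_range.1 hr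
        omega
      rw [show ((a + 1 : ℕ) : ℤ) + (b + 1 : ℕ) - 2 * r - 1 = ((b + a + 1 - 2 * r : ℕ) : ℤ) by
          omega, show ((a + 1 : ℕ) : ℤ) - 1 = (a : ℤ) by omega,
        zbinom_natCast, show a + 1 + (b + 1) = b + a + 2 by ring]
    · intro r _ hr
      have hr' : b + 1 < 2 * r := by
        have := mt Finset.mem_range.2 hr
        omega
      rw [zbinom_of_lt (by omega)]
      simp
  rw [e1, e2, Nat.choose_symm_of_eq_add (show a + b + 1 = b + (a + 1) by ring),
    Nat.choose_symm_of_eq_add (show a + b + 1 = (b + 1) + a by ring), add_comm b a]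
  simp only [add_mul, Finset.sum_add_distrib]
  ring

/-- Comparison with the convergent Tornheim series `Σ 1 / (m * n * (m + n))`. -/
lemma summable_tornheim (v : ℕ+ × ℕ+ → ℂ) (h : ∀ p, ‖v p‖ ≤
      ((p.1 : ℕ) : ℝ)⁻¹ * ((p.2 : ℕ) : ℝ)⁻¹ * (((p.1 : ℕ) : ℝ) + (p.2 : ℕ))⁻¹) : Summable v := by
  have hs : Summable (fun k : ℕ+ => (((k : ℕ) : ℝ) ^ (3 / 2 : ℝ))⁻¹) :=
    (Real.summable_nat_rpow_inv.2 (by norm_num : (1 : ℝ) < 3 / 2)).comp_injective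
      PNat.coe_injective
  have hp := hs.mul_of_nonneg hs (fun _ => by positivity) (fun _ => by positivity)
  refine Summable.of_norm_bounded hp fun p => (h p).trans ?_
  obtain ⟨m, n⟩ := p
  have hm : (0 : ℝ) < (m : ℕ) := by exact_mod_cast m.pos
  have hn : (0 : ℝ) < (n : ℕ) := by exact_mod_cast n.pos
  generalize ((m : ℕ) : ℝ) = x at *
  generalize ((n : ℕ) : ℝ) = t at *
  rw [← mul_inv, ← mul_inv, ← mul_inv]
  have key : ∀ x : ℝ, 0 < x → x ^ (3 / 2 : ℝ) = x * √x := fun x hx => by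
    rw [show (3 / 2 : ℝ) = 1 + 1 / 2 by norm_num, Real.rpow_add hx, Real.rpow_one,
      Real.sqrt_eq_rpow]
  rw [key x hm, key t hn]
  refine inv_anti₀ (by positivity) ?_
  have h3 : √x * √t ≤ x + t := by
    nlinarith [Real.sq_sqrt hm.le, Real.sq_sqrt hn.le, sq_nonneg (√x - √t),
      Real.sqrt_nonneg x, Real.sqrt_nonneg t]
  calc x * √x * (t * √t) = x * t * (√x * √t) := by ring
    _ ≤ x * t * (x + t) := by gcongr

lemma norm_cpow_inv_le (n : ℕ) (hn : 1 ≤ n) (s : ℂ) (hs : 1 ≤ s.re) :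
    ‖((n : ℂ) ^ s)⁻¹‖ ≤ (n : ℝ)⁻¹ := by
  rw [norm_inv, Complex.norm_natCast_cpow_of_pos (by omega)]
  have h1 : (1 : ℝ) ≤ n := by exact_mod_cast hn
  refine inv_anti₀ (by positivity) ?_
  simpa using Real.rpow_le_rpow_of_exponent_le h1 hs

lemma LMT_two (s₁ s₂ t : ℂ) (w₁ w₂ w₃ : ℕ → ℂ) :
    LMT (k := 2) ![s₁, s₂] t ![w₁, w₂, w₃] = ∑' p : ℕ+ × ℕ+,
      (w₁ p.1 * (((p.1 : ℕ) : ℂ) ^ s₁)⁻¹) * (w₂ p.2 * (((p.2 : ℕ) : ℂ) ^ s₂)⁻¹) *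
        (w₃ ((p.1 : ℕ) + (p.2 : ℕ)) * ((((p.1 : ℕ) + (p.2 : ℕ) : ℕ) : ℂ) ^ t)⁻¹) := by
  unfold LMT
  rw [← (finTwoArrowEquiv ℕ+).tsum_eq]
  refine tsum_congr fun m => ?_
  simp [Fin.sum_univ_two, Fin.prod_univ_two, finTwoArrowEquiv, Fin.last]

lemma hasSum_LMT_two (s₁ s₂ t : ℂ) (w₁ w₂ w₃ : ℕ → ℂ) (h₁ : 1 ≤ s₁.re) (h₂ : 1 ≤ s₂.re)
    (ht : 1 ≤ t.re) (hw₁ : ∀ n, ‖w₁ n‖ ≤ 1) (hw₂ : ∀ n, ‖w₂ n‖ ≤ 1) (hw₃ : ∀ n, ‖w₃ n‖ ≤ 1) :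
    HasSum (fun p : ℕ+ × ℕ+ =>
      (w₁ p.1 * (((p.1 : ℕ) : ℂ) ^ s₁)⁻¹) * (w₂ p.2 * (((p.2 : ℕ) : ℂ) ^ s₂)⁻¹) *
        (w₃ ((p.1 : ℕ) + (p.2 : ℕ)) * ((((p.1 : ℕ) + (p.2 : ℕ) : ℕ) : ℂ) ^ t)⁻¹))
      (LMT (k := 2) ![s₁, s₂] t ![w₁, w₂, w₃]) := by
  rw [LMT_two]
  have key : ∀ (w : ℕ → ℂ) (s : ℂ), (∀ n, ‖w n‖ ≤ 1) → 1 ≤ s.re → ∀ n : ℕ, 1 ≤ n →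
      ‖w n * ((n : ℂ) ^ s)⁻¹‖ ≤ (n : ℝ)⁻¹ := fun w s hw hs n hn => by
    rw [norm_mul]
    exact (mul_le_mul (hw n) (norm_cpow_inv_le n hn s hs) (norm_nonneg _) zero_le_one).trans
      (one_mul _).le
  refine (summable_tornheim _ fun p => ?_).hasSum
  rw [norm_mul, norm_mul, ← Nat.cast_add]
  gcongr
  · exact key w₁ s₁ hw₁ h₁ _ p.1.pos
  · exact key w₂ s₂ hw₂ h₂ _ p.2.pos
  · exact key w₃ t hw₃ ht _ (by have := p.1.pos; omega)

lemma hasSum_Lgen (w : ℕ → ℂ) (hw : ∀ n, ‖w n‖ ≤ 1) (s : ℂ) (hs : 1 < s.re) :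
    HasSum (fun m : ℕ+ => w (m : ℕ) * (((m : ℕ) : ℂ) ^ s)⁻¹) (Lgen w s) := by
  refine Summable.hasSum ?_
  have h : Summable (fun k : ℕ+ => (((k : ℕ) : ℝ) ^ s.re)⁻¹) :=
    (Real.summable_nat_rpow_inv.2 hs).comp_injective PNat.coe_injective
  refine Summable.of_norm_bounded h fun m => ?_
  rw [norm_mul, norm_inv, Complex.norm_natCast_cpow_of_pos m.pos]
  exact mul_le_of_le_one_left (by positivity) (hw m)

lemma hasSum_weighted_slice (w : ℕ → ℂ) (hw : ∀ n, ‖w n‖ ≤ 1) (a b : ℕ) (ha : 1 ≤ a)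
    (hb : 1 ≤ b) (z : ℂ) (hz : 1 ≤ z.re) :
    HasSum (fun p : ℕ+ × ℕ+ => w p.1 * (((p.1 : ℕ) : ℂ) ^ z)⁻¹ * slice p.1 p.2 a b)
      (LMT (k := 2) ![(a : ℂ), (b : ℂ)] z ![fun _ => 1, fun _ => 1, w]
      + (-1 : ℂ) ^ b * LMT (k := 2) ![z, (b : ℂ)] (a : ℂ) ![w, fun _ => 1, fun _ => 1]
      + (-1 : ℂ) ^ a * LMT (k := 2) ![(a : ℂ), z] (b : ℂ) ![fun _ => 1, w, fun _ => 1]) := by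
  have ha' : 1 ≤ (a : ℂ).re := by simpa using ha
  have hb' : 1 ≤ (b : ℂ).re := by simpa using hb
  have h1 : ∀ n : ℕ, ‖(fun _ : ℕ => (1 : ℂ)) n‖ ≤ 1 := by simp
  have s1 := hasSum_LMT_two a b z _ _ w ha' hb' hz h1 h1 hw
  have s2 := hasSum_LMT_two z b a w _ _ hz hb' ha' hw h1 h1
  have s3 := hasSum_LMT_two a z b _ w _ ha' hz hb' h1 hw h1
  have hinj : Function.Injective (fun p : ℕ+ × ℕ+ => (p.1 + p.2, p.1)) := by
    rintro ⟨m, n⟩ ⟨m', n'⟩ h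
    simp only [Prod.mk.injEq] at h
    obtain ⟨h, rfl⟩ := h
    simpa using h
  have t1 : HasSum (fun p : ℕ+ × ℕ+ => w p.1 * (((p.1 : ℕ) : ℂ) ^ z)⁻¹ *
      (if p.2 < p.1 then (((p.2 : ℕ) : ℂ) ^ a)⁻¹ * ((((p.1 : ℕ) : ℂ) - (p.2 : ℕ)) ^ b)⁻¹ else 0))
      (LMT (k := 2) ![(a : ℂ), (b : ℂ)] z ![fun _ => 1, fun _ => 1, w]) := by
    rw [← hinj.hasSum_iff]
    · convert s1 using 1
      funext p
      have : p.1 < p.1 + p.2 := PNat.lt_add_right _ _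
      simp [this]
      ring
    · rintro ⟨m, n⟩ h
      rw [if_neg, mul_zero]
      intro hlt
      exact h ⟨(n, m - n), by simp [PNat.add_sub_of_lt hlt]⟩
  have t3 := (Equiv.prodComm ℕ+ ℕ+).hasSum_iff.2 s3
  convert (t1.add (s2.mul_left _)).add (t3.mul_left _) using 1
  funext p
  simp only [slice, Function.comp, Equiv.prodComm_apply, Prod.fst_swap, Prod.snd_swap,
    cpow_natCast, Nat.cast_add]
  split_ifs <;> ring

theorem stmt3 (a b : ℕ) (ha : 1 ≤ a) (hb : 1 ≤ b)
    (N : ℕ) (χ : DirichletCharacter ℂ N) (hχ : χ.IsPrimitive)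
    (z : ℂ) (hz : 1 ≤ z.re) :
    LMT (k := 2) ![(a : ℂ), (b : ℂ)] z
        ![fun _ => 1, fun _ => 1, fun n : ℕ => χ (n : ZMod N)]
      + (-1 : ℂ) ^ b * LMT (k := 2) ![z, (b : ℂ)] (a : ℂ)
          ![fun n : ℕ => χ (n : ZMod N), fun _ => 1, fun _ => 1]
      + (-1 : ℂ) ^ a * LMT (k := 2) ![(a : ℂ), z] (b : ℂ)
          ![fun _ => 1, fun n : ℕ => χ (n : ZMod N), fun _ => 1]
    = 2 * ∑ r ∈ Finset.range (max a b / 2 + 1),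
        ((zbinom ((a : ℤ) + b - 2 * r - 1) ((a : ℤ) - 1) : ℂ) +
            (zbinom ((a : ℤ) + b - 2 * r - 1) ((a : ℤ) - 2 * r) : ℂ)) *
          riemannZeta ((2 * r : ℕ) : ℂ) *
            Lgen (fun n : ℕ => χ (n : ZMod N)) ((a : ℂ) + (b : ℂ) + z - 2 * r) := by
  have hw : ∀ n : ℕ, ‖(fun n : ℕ => χ (n : ZMod N)) n‖ ≤ 1 := fun n => χ.norm_le_one _
  have hM : ∀ M : ℕ+, HasSum
      (fun k : ℕ+ => χ ((M : ℕ) : ZMod N) * (((M : ℕ) : ℂ) ^ z)⁻¹ * slice M k a b)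
      (χ ((M : ℕ) : ZMod N) * (((M : ℕ) : ℂ) ^ z)⁻¹ * _) :=
    fun M => (hasSum_slice M a b ha hb).mul_left _
  have hT := hasSum_weighted_slice (fun n : ℕ => χ (n : ZMod N)) hw a b ha hb z hz
  have h := hT.prod_fiberwise hM
  let c : ℕ → ℂ := fun r => ((zbinom ((a : ℤ) + b - 2 * r - 1) ((a : ℤ) - 1) : ℂ) +
      (zbinom ((a : ℤ) + b - 2 * r - 1) ((a : ℤ) - 2 * r) : ℂ)) * riemannZeta ((2 * r : ℕ) : ℂ)
  have hL : ∀ r ∈ Finset.range (max a b / 2 + 1), HasSum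
      (fun M : ℕ+ => c r * (χ ((M : ℕ) : ZMod N) *
        (((M : ℕ) : ℂ) ^ ((a : ℂ) + (b : ℂ) + z - 2 * r))⁻¹))
      (c r * Lgen (fun n : ℕ => χ (n : ZMod N)) ((a : ℂ) + (b : ℂ) + z - 2 * r)) := fun r hr =>
    (hasSum_Lgen _ hw ((a : ℂ) + (b : ℂ) + z - 2 * r) (by
      have h1 : 2 * r + 1 ≤ a + b := by
        have := Finset.mem_range.1 hr
        omega
      have h2 : (2 * r + 1 : ℝ) ≤ a + b := by exact_mod_cast h1
      simp
      linarith)).mul_left _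
  refine h.unique (hasSum_of_eq ((hasSum_sum hL).mul_left 2) (fun M => ?_) rfl)
  rw [mul_left_comm, Finset.mul_sum]
  congr 1
  refine Finset.sum_congr rfl fun r hr => ?_
  have h1 : 2 * r ≤ a + b := by
    have := Finset.mem_range.1 hr
    omega
  have hM : ((M : ℕ) : ℂ) ≠ 0 := by simp
  rw [show (a : ℂ) + (b : ℂ) + z - 2 * r = z + ((a + b - 2 * r : ℕ) : ℂ) by
    push_cast [Nat.cast_sub h1]
    ring, Complex.cpow_add _ _ hM, Complex.cpow_natCast, mul_inv, inv_pow]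
  simp only [c]
  ring
end

section
/- ζ_MT(2,2,2,2,2) = (12/5) [ 2ζ(2) ζ_MT(2,2,2,2) + 24ζ(2) ζ_MT(2,2,4) − 10ζ(4) ζ_MT(2,2,2) − 30 ζ_MT(2,2,6) − 3 ζ_MT(2,2,2,4) ] + 2ζ(10). -/
/-- The Riemann zeta value `ζ(n) = Σ_{m≥1} 1/m^n`. -/
noncomputable def rzeta (n : ℕ) : ℝ := ∑' m : ℕ+, (((m : ℕ) : ℝ) ^ n)⁻¹

/-- The Fourier series `∑ e(m t) / m²` over positive `m`, where `e(x) = exp (2 π i x)`. -/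
noncomputable def dilogCircle (t : ℝ) : ℂ :=
  ∑' m : ℕ+, (((m : ℕ) : ℂ) ^ 2)⁻¹ * Complex.exp (2 * Real.pi * Complex.I * (m : ℕ) * t)

lemma norm_exp_two_pi_I_nat_mul (n : ℕ) (t : ℝ) :
    ‖Complex.exp (2 * Real.pi * Complex.I * n * t)‖ = 1 := by
  rw [show (2 * Real.pi * Complex.I * n * t : ℂ) = ((2 * Real.pi * n * t : ℝ) : ℂ) * Complex.I by
    push_cast; ring]
  exact Complex.norm_exp_ofReal_mul_I _

lemma hasSum_pnat_of_hasSum_nat {E : Type*} [AddCommGroup E] [TopologicalSpace E]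
    [IsTopologicalAddGroup E] {f : ℕ → E} {a : E} (h0 : f 0 = 0) (h : HasSum f a) :
    HasSum (fun m : ℕ+ => f m) a := by
  refine (Function.Injective.hasSum_iff PNat.coe_injective ?_).mpr h
  intro x hx
  rcases Nat.eq_zero_or_pos x with rfl | hp
  · exact h0
  · exact absurd ⟨⟨x, hp⟩, rfl⟩ hx

lemma summable_pnat_inv_sq : Summable fun m : ℕ+ => (((m : ℕ) : ℝ) ^ 2)⁻¹ :=
  (Real.summable_nat_pow_inv.mpr one_lt_two).comp_injective PNat.coe_injective

lemma norm_dilogCircle_term (m : ℕ+) (t : ℝ) :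
    ‖(((m : ℕ) : ℂ) ^ 2)⁻¹ * Complex.exp (2 * Real.pi * Complex.I * (m : ℕ) * t)‖
      = (((m : ℕ) : ℝ) ^ 2)⁻¹ := by
  rw [norm_mul, norm_exp_two_pi_I_nat_mul]
  simp

lemma continuous_dilogCircle : Continuous dilogCircle :=
  continuous_tsum (fun _ => by fun_prop) summable_pnat_inv_sq
    fun m t => (norm_dilogCircle_term m t).le

/-- Powers of an absolutely convergent series, expanded as multiple series. -/
lemma hasSum_prod_fin {ι R : Type*} [NormedCommRing R] [NormOneClass R] [CompleteSpace R]
    {f : ι → R} (hf : Summable fun i => ‖f i‖) (k : ℕ) :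
    (Summable fun m : Fin k → ι => ‖∏ j, f (m j)‖) ∧
      HasSum (fun m : Fin k → ι => ∏ j, f (m j)) ((∑' i, f i) ^ k) := by
  induction k with
  | zero =>
    refine ⟨Summable.of_finite, ?_⟩
    simp
  | succ k ih =>
    have hnorm := hf.mul_norm ih.1
    have hsum := hf.of_norm.hasSum.mul ih.2 hnorm.of_norm
    rw [← (Fin.consEquiv fun _ : Fin (k + 1) => ι).summable_iff,
      ← (Fin.consEquiv fun _ : Fin (k + 1) => ι).hasSum_iff, pow_succ']
    constructor
    · simpa [Function.comp_def, Fin.consEquiv, Fin.prod_univ_succ] using hnorm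
    · simpa [Function.comp_def, Fin.consEquiv, Fin.prod_univ_succ] using hsum

lemma prod_dilogCircle_term {k : ℕ} (m : Fin k → ℕ+) (t : ℝ) :
    ∏ j, ((((m j : ℕ) : ℂ) ^ 2)⁻¹ * Complex.exp (2 * Real.pi * Complex.I * (m j : ℕ) * t))
      = (∏ j, ((m j : ℕ) : ℂ) ^ 2)⁻¹
        * Complex.exp (2 * Real.pi * Complex.I * (∑ j, (m j : ℕ) : ℕ) * t) := by
  rw [Finset.prod_mul_distrib, Finset.prod_inv_distrib, ← Complex.exp_sum]
  push_cast
  rw [Finset.mul_sum, Finset.sum_mul]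

/-- Integrating a power of `dilogCircle` against a weight whose Fourier coefficients are known. -/
lemma hasSum_integral_dilogCircle_pow_mul {k : ℕ} {w : ℝ → ℂ} (hw : Continuous w) {c : ℕ → ℂ}
    (hk : k ≠ 0)
    (hc : ∀ n : ℕ, n ≠ 0 →
      ∫ t in (0 : ℝ)..1, Complex.exp (2 * Real.pi * Complex.I * n * t) * w t = c n) :
    HasSum (fun m : Fin k → ℕ+ => (∏ j, ((m j : ℕ) : ℂ) ^ 2)⁻¹ * c (∑ j, (m j : ℕ)))
      (∫ t in (0 : ℝ)..1, dilogCircle t ^ k * w t) := by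
  have hs : Summable fun m : Fin k → ℕ+ => (∏ j, ((m j : ℕ) : ℝ) ^ 2)⁻¹ := by
    have := (hasSum_prod_fin (f := fun m : ℕ+ => (((m : ℕ) : ℝ) ^ 2)⁻¹)
      summable_pnat_inv_sq.norm k).1.of_norm
    simpa only [Finset.prod_inv_distrib] using this
  have key := intervalIntegral.hasSum_integral_of_dominated_convergence
    (μ := MeasureTheory.volume) (a := 0) (b := 1)
    (F := fun (m : Fin k → ℕ+) t => ((∏ j, ((m j : ℕ) : ℂ) ^ 2)⁻¹
        * Complex.exp (2 * Real.pi * Complex.I * (∑ j, (m j : ℕ) : ℕ) * t)) * w t)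
    (f := fun t => dilogCircle t ^ k * w t)
    (fun m t => (∏ j, ((m j : ℕ) : ℝ) ^ 2)⁻¹ * ‖w t‖) ?_ ?_ ?_ ?_ ?_
  · refine key.congr_fun fun m => ?_
    have hn : (∑ j, (m j : ℕ)) ≠ 0 := by
      have : 0 < ∑ j, (m j : ℕ) :=
        Finset.sum_pos (fun j _ => (m j).pos) ⟨⟨0, Nat.pos_of_ne_zero hk⟩, Finset.mem_univ _⟩
      exact this.ne'
    simp_rw [mul_assoc _ (Complex.exp _)]
    rw [intervalIntegral.integral_const_mul, hc _ hn]
  · intro m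
    exact Continuous.aestronglyMeasurable (by fun_prop)
  · intro m
    refine Filter.Eventually.of_forall fun t _ => ?_
    rw [norm_mul, norm_mul, norm_exp_two_pi_I_nat_mul]
    simp
  · exact Filter.Eventually.of_forall fun t _ => hs.mul_right _
  · simp_rw [tsum_mul_right]
    exact Continuous.intervalIntegrable (by fun_prop) _ _
  · refine Filter.Eventually.of_forall fun t _ => HasSum.mul_right _ ?_
    have := (hasSum_prod_fin (f := fun m : ℕ+ => (((m : ℕ) : ℂ) ^ 2)⁻¹
      * Complex.exp (2 * Real.pi * Complex.I * (m : ℕ) * t))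
      (by simpa only [norm_dilogCircle_term] using summable_pnat_inv_sq) k).2
    simp only [prod_dilogCircle_term] at this
    exact this

lemma integral_exp_mul_bernoulliFun {k : ℕ} (hk : k ≠ 0) (n : ℕ) :
    ∫ t in (0 : ℝ)..1, Complex.exp (2 * Real.pi * Complex.I * n * t) * (bernoulliFun k t : ℂ)
      = -(k.factorial : ℂ) / (2 * Real.pi * Complex.I * (-n)) ^ k := by
  have h := bernoulliFourierCoeff_eq hk (-(n : ℤ))
  rw [bernoulliFourierCoeff, fourierCoeffOn_eq_integral] at h
  simp only [fourier_coe_apply] at h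
  simpa using h

lemma integral_exp_two_pi_I_nat {n : ℕ} (hn : n ≠ 0) :
    ∫ t in (0 : ℝ)..1, Complex.exp (2 * Real.pi * Complex.I * n * t) = 0 := by
  have h := bernoulli_zero_fourier_coeff (n := -(n : ℤ)) (by simpa using hn)
  rw [bernoulliFourierCoeff, fourierCoeffOn_eq_integral] at h
  simp only [fourier_coe_apply] at h
  simpa using h

lemma integral_re_dilogCircle_pow {k : ℕ} (hk : k ≠ 0) :
    ∫ t in (0 : ℝ)..1, (dilogCircle t ^ k).re = 0 := by
  have h := hasSum_integral_dilogCircle_pow_mul (w := fun _ => 1) (c := fun _ => 0)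
    continuous_const hk (fun n hn => by simpa using integral_exp_two_pi_I_nat hn)
  simp only [mul_zero, mul_one] at h
  have h0 := h.unique hasSum_zero
  have hi : IntervalIntegrable (fun t => dilogCircle t ^ k) MeasureTheory.volume 0 1 :=
    (continuous_dilogCircle.pow k).intervalIntegrable _ _
  have hre := Complex.reCLM.intervalIntegral_comp_comm hi
  simp only [Complex.reCLM_apply] at hre
  rw [hre, h0, Complex.zero_re]

lemma integral_re_dilogCircle_pow_mul_bernoulliFun {k r : ℕ} (hk : k ≠ 0) (hr : r ≠ 0)
    (s : Fin (k + 1) → ℕ) (hs : ∀ j : Fin k, s j.castSucc = 2) (hl : s (Fin.last k) = 2 * r) :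
    ∫ t in (0 : ℝ)..1, (dilogCircle t ^ k).re * bernoulliFun (2 * r) t
      = (-1) ^ (r + 1) * (2 * r).factorial / (2 * Real.pi) ^ (2 * r) * MTZ s := by
  have hr' : 2 * r ≠ 0 := by omega
  have h := hasSum_integral_dilogCircle_pow_mul (w := fun t => (bernoulliFun (2 * r) t : ℂ))
    (Complex.continuous_ofReal.comp (continuous_bernoulliFun _)) hk
    (fun n _ => integral_exp_mul_bernoulliFun hr' n)
  have hterm (m : Fin k → ℕ+) :
      (∏ j, ((m j : ℕ) : ℂ) ^ 2)⁻¹ * (-((2 * r).factorial : ℂ)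
        / (2 * Real.pi * Complex.I * (-(∑ j, (m j : ℕ) : ℕ))) ^ (2 * r))
      = (((-1) ^ (r + 1) * (2 * r).factorial / (2 * Real.pi) ^ (2 * r)
        * ((∏ j : Fin k, ((m j : ℕ) : ℝ) ^ s j.castSucc)⁻¹ *
          ((∑ j : Fin k, ((m j : ℕ) : ℝ)) ^ s (Fin.last k))⁻¹) : ℝ) : ℂ) := by
    simp only [hs, hl]
    have hI : (2 * Real.pi * Complex.I * (-(∑ j, (m j : ℕ) : ℕ)) : ℂ) ^ (2 * r)
        = (-1) ^ r * ((2 * Real.pi) ^ (2 * r) * (∑ j, ((m j : ℕ) : ℂ)) ^ (2 * r)) := by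
      push_cast
      rw [mul_neg, Even.neg_pow (even_two_mul r), mul_pow, mul_pow _ Complex.I, pow_mul Complex.I,
        Complex.I_sq]
      ring
    rw [hI]
    have hsq : ((-1 : ℂ) ^ r)⁻¹ = (-1) ^ r := by
      rw [← inv_pow]; norm_num
    push_cast
    rw [div_eq_mul_inv, mul_inv, hsq, mul_inv]
    ring
  simp only [hterm] at h
  have hi : IntervalIntegrable (fun t => dilogCircle t ^ k * (bernoulliFun (2 * r) t : ℂ))
      MeasureTheory.volume 0 1 :=
    ((continuous_dilogCircle.pow k).mul
      (Complex.continuous_ofReal.comp (continuous_bernoulliFun _))).intervalIntegrable _ _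
  have hre := Complex.reCLM.intervalIntegral_comp_comm hi
  simp only [Complex.reCLM_apply, Complex.re_mul_ofReal] at hre
  have h' := Complex.hasSum_re h
  simp only [Complex.ofReal_re] at h'
  rw [hre, ← h'.tsum_eq, tsum_mul_left, MTZ]

lemma re_dilogCircle {t : ℝ} (ht : t ∈ Set.Icc (0 : ℝ) 1) :
    (dilogCircle t).re = Real.pi ^ 2 * bernoulliFun 2 t := by
  have h := hasSum_pnat_of_hasSum_nat (by simp) (hasSum_one_div_nat_pow_mul_cos one_ne_zero ht)
  have hs : Summable fun m : ℕ+ =>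
      (((m : ℕ) : ℂ) ^ 2)⁻¹ * Complex.exp (2 * Real.pi * Complex.I * (m : ℕ) * t) :=
    .of_norm (by simpa only [norm_dilogCircle_term] using summable_pnat_inv_sq)
  have h2 := Complex.hasSum_re hs.hasSum
  have hval : Real.pi ^ 2 * bernoulliFun 2 t = (-1) ^ (1 + 1) * (2 * Real.pi) ^ (2 * 1) / 2
      / (2 * 1).factorial * bernoulliFun (2 * 1) t := by
    simp only [Nat.factorial]
    push_cast
    ring
  rw [hval]
  refine h2.unique (h.congr_fun fun m => ?_)
  have : (2 * Real.pi * Complex.I * (m : ℕ) * t : ℂ)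
      = ((2 * Real.pi * (m : ℕ) * t : ℝ) : ℂ) * Complex.I := by push_cast; ring
  rw [this, show ((((m : ℕ) : ℂ) ^ 2)⁻¹) = (((((m : ℕ) : ℝ) ^ 2)⁻¹ : ℝ) : ℂ) by push_cast; rfl,
    Complex.re_ofReal_mul, Complex.exp_ofReal_mul_I_re]
  simp

lemma bernoulli_four : bernoulli 4 = -1 / 30 := by
  rw [bernoulli_eq_bernoulli'_of_ne_one (by norm_num), bernoulli'_four]

lemma bernoulli'_six : bernoulli' 6 = 1 / 42 := by
  rw [bernoulli'_def]
  norm_num [Finset.sum_range_succ, Nat.choose, bernoulli'_eq_zero_of_odd (n := 5) (by decide)]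

lemma bernoulli_six : bernoulli 6 = 1 / 42 := by
  rw [bernoulli_eq_bernoulli'_of_ne_one (by norm_num), bernoulli'_six]

lemma bernoulli'_eight : bernoulli' 8 = -1 / 30 := by
  rw [bernoulli'_def]
  norm_num [Finset.sum_range_succ, Nat.choose, bernoulli'_eq_zero_of_odd (n := 5) (by decide),
    bernoulli'_eq_zero_of_odd (n := 7) (by decide), bernoulli'_six]

lemma bernoulli_ten : bernoulli 10 = 5 / 66 := by
  rw [bernoulli_eq_bernoulli'_of_ne_one (by norm_num), bernoulli'_def]
  norm_num [Finset.sum_range_succ, Nat.choose, bernoulli'_eq_zero_of_odd (n := 5) (by decide),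
    bernoulli'_eq_zero_of_odd (n := 7) (by decide), bernoulli'_eq_zero_of_odd (n := 9) (by decide),
    bernoulli'_six, bernoulli'_eight]

lemma bernoulliFun_four (x : ℝ) :
    bernoulliFun 4 x = x ^ 4 - 2 * x ^ 3 + x ^ 2 - 1 / 30 := by
  norm_num [bernoulliFun, Polynomial.bernoulli_def, Finset.sum_range_succ, Nat.choose,
    bernoulli_eq_zero_of_odd (n := 3) (by decide), bernoulli_four]
  ring

lemma bernoulliFun_six (x : ℝ) :
    bernoulliFun 6 x = x ^ 6 - 3 * x ^ 5 + 5 / 2 * x ^ 4 - x ^ 2 / 2 + 1 / 42 := by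
  norm_num [bernoulliFun, Polynomial.bernoulli_def, Finset.sum_range_succ, Nat.choose,
    bernoulli_eq_zero_of_odd (n := 3) (by decide), bernoulli_eq_zero_of_odd (n := 5) (by decide),
    bernoulli_four, bernoulli_six]
  ring

lemma rzeta_eq {n : ℕ} (hn : n ≠ 0) {a : ℝ} (h : HasSum (fun m : ℕ => 1 / (m : ℝ) ^ n) a) :
    rzeta n = a := by
  have := hasSum_pnat_of_hasSum_nat (by simp [hn]) h
  simp only [one_div] at this
  exact this.tsum_eq

lemma rzeta_two : rzeta 2 = Real.pi ^ 2 / 6 := rzeta_eq two_ne_zero hasSum_zeta_two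

lemma rzeta_four : rzeta 4 = Real.pi ^ 4 / 90 := rzeta_eq four_ne_zero hasSum_zeta_four

lemma rzeta_ten : rzeta 10 = Real.pi ^ 10 / 93555 := by
  rw [rzeta_eq (by norm_num) (hasSum_zeta_nat (k := 5) (by norm_num))]
  norm_num [bernoulli_ten, Nat.factorial]
  ring

lemma integral_bernoulliFun_two_pow_five :
    ∫ t in (0 : ℝ)..1, bernoulliFun 2 t ^ 5 = 1 / 149688 := by
  let P : Polynomial ℝ :=
    .C (1 / 11) * .X ^ 11 + .C (-1 / 2) * .X ^ 10 + .C (65 / 54) * .X ^ 9 + .C (-5 / 3) * .X ^ 8 +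
    .C (185 / 126) * .X ^ 7 + .C (-31 / 36) * .X ^ 6 + .C (37 / 108) * .X ^ 5 + .C (-5 / 54) * .X ^ 4 +
    .C (65 / 3888) * .X ^ 3 + .C (-5 / 2592) * .X ^ 2 + .C (1 / 7776) * .X
  have h (t : ℝ) : HasDerivAt (fun t => P.eval t) (bernoulliFun 2 t ^ 5) t := by
    convert! P.hasDerivAt t using 1
    simp [P]
    ring
  rw [intervalIntegral.integral_eq_sub_of_hasDerivAt (fun t _ => h t)
    (((continuous_bernoulliFun 2).pow 5).intervalIntegrable _ _)]
  norm_num [P]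

/-- The pointwise identity behind the theorem, with the even powers of the real part of `z`
linearized against Bernoulli polynomials. -/
lemma two_mul_re_pow_four (z : ℂ) {t : ℝ} (hz : z.re = Real.pi ^ 2 * bernoulliFun 2 t) :
    2 * Real.pi ^ 2 * ((z ^ 4).re * bernoulliFun 2 t)
      = 24 / 5 * Real.pi ^ 4 * ((z ^ 3).re * bernoulliFun 4 t)
        + 8 / 5 * Real.pi ^ 4 * ((z ^ 3).re * bernoulliFun 2 t)
        - 32 / 5 * Real.pi ^ 6 * ((z ^ 2).re * bernoulliFun 6 t)
        - 32 / 5 * Real.pi ^ 6 * ((z ^ 2).re * bernoulliFun 4 t)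
        - 8 / 15 * Real.pi ^ 6 * ((z ^ 2).re * bernoulliFun 2 t)
        + 16 / 5 * Real.pi ^ 10 * bernoulliFun 2 t ^ 5
        + 2 / 5 * (z ^ 5).re + 2 / 75 * Real.pi ^ 4 * (z ^ 3).re
        - 8 / 4725 * Real.pi ^ 6 * (z ^ 2).re := by
  obtain ⟨x, y⟩ := z
  have h4 : bernoulliFun 4 t = bernoulliFun 2 t ^ 2 - bernoulliFun 2 t / 3 - 1 / 180 := by
    rw [bernoulliFun_four, bernoulliFun_two]; ring
  have h6 : bernoulliFun 6 t = bernoulliFun 2 t ^ 3 - bernoulliFun 4 t - bernoulliFun 2 t / 12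
      - 1 / 3780 := by
    rw [bernoulliFun_six, bernoulliFun_four, bernoulliFun_two]; ring
  rw [h6, h4]
  simp only at hz
  simp only [pow_succ, pow_zero, one_mul, Complex.mul_re, Complex.mul_im, hz]
  ring

theorem stmt17 :
    MTZ (k := 4) ![2, 2, 2, 2, 2]
      = 12 / 5 * (2 * rzeta 2 * MTZ (k := 3) ![2, 2, 2, 2]
          + 24 * rzeta 2 * MTZ (k := 2) ![2, 2, 4]
          - 10 * rzeta 4 * MTZ (k := 2) ![2, 2, 2]
          - 30 * MTZ (k := 2) ![2, 2, 6]
          - 3 * MTZ (k := 3) ![2, 2, 2, 4])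
        + 2 * rzeta 10 := by
  have hD := continuous_dilogCircle
  have hB := continuous_bernoulliFun
  have main := intervalIntegral.integral_congr (μ := MeasureTheory.volume) (a := 0) (b := 1)
    fun t ht => two_mul_re_pow_four (dilogCircle t)
      (re_dilogCircle (by rwa [Set.uIcc_of_le zero_le_one] at ht))
  have h42 := integral_re_dilogCircle_pow_mul_bernoulliFun (k := 4) (r := 1) (by norm_num)
    (by norm_num) ![2, 2, 2, 2, 2] (by decide) rfl
  have h34 := integral_re_dilogCircle_pow_mul_bernoulliFun (k := 3) (r := 2) (by norm_num)
    (by norm_num) ![2, 2, 2, 4] (by decide) rfl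
  have h32 := integral_re_dilogCircle_pow_mul_bernoulliFun (k := 3) (r := 1) (by norm_num)
    (by norm_num) ![2, 2, 2, 2] (by decide) rfl
  have h26 := integral_re_dilogCircle_pow_mul_bernoulliFun (k := 2) (r := 3) (by norm_num)
    (by norm_num) ![2, 2, 6] (by decide) rfl
  have h24 := integral_re_dilogCircle_pow_mul_bernoulliFun (k := 2) (r := 2) (by norm_num)
    (by norm_num) ![2, 2, 4] (by decide) rfl
  have h22 := integral_re_dilogCircle_pow_mul_bernoulliFun (k := 2) (r := 1) (by norm_num)
    (by norm_num) ![2, 2, 2] (by decide) rfl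
  norm_num [Nat.factorial, -bernoulliFun_two] at h42 h34 h32 h26 h24 h22
  rw [intervalIntegral.integral_sub, intervalIntegral.integral_add, intervalIntegral.integral_add,
    intervalIntegral.integral_add, intervalIntegral.integral_sub, intervalIntegral.integral_sub,
    intervalIntegral.integral_sub, intervalIntegral.integral_add] at main
  · simp only [intervalIntegral.integral_const_mul, integral_bernoulliFun_two_pow_five,
      integral_re_dilogCircle_pow two_ne_zero, integral_re_dilogCircle_pow three_ne_zero,
      integral_re_dilogCircle_pow (k := 5) (by norm_num), h42, h34, h32, h26, h24, h22] at main
    have hpi := Real.pi_ne_zero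
    rw [rzeta_two, rzeta_four, rzeta_ten]
    field_simp at main ⊢
    linear_combination main / 1008000
  all_goals exact Continuous.intervalIntegrable (by fun_prop) _ _
end
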